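/- (Recovery sequences in the critical regime, Theorem 4.9, laminate case A' ≠ B'.) Fix γ ∈ (0,∞) and assume W is continuous and satisfies (H1)–(H4) and the normalization of the wells with a ≠ 0. Let (u, b) be the laminate configuration with interfaces α₁ < ⋯ < α_m, and let h_n → 0⁺, ε_n → 0⁺ be arbitrary sequences with h_n/ε_n → γ. Then there exists a sequence of C² maps u_n : ℝ³ → ℝ³ such that ∫_Ω (|u_n − u|^p + |∂₁u_n(x) − ū'(x₁)|^p + |∂₂u_n|^p) dx → 0, ∫_Ω |h_n⁻¹∂₃u_n − b|^p dx → 0, and lim_{n→∞} F^{h_n}_{ε_n}(u_n, Ω) = K_γ · Σ_{i=1}^m ℒ¹(J_i). -/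

import Mathlib

open MeasureTheory Filter Topology ENNReal NNReal Set

noncomputable section

/-- Vectors in ℝ³. -/
abbrev V3 := Fin 3 → ℝ

/-- 3×3 matrices, represented as the triple of their columns. -/
abbrev M33 := Fin 3 → V3

/-- Euclidean norm on ℝ³. -/
def vnorm (v : V3) : ℝ := Real.sqrt (∑ i, (v i) ^ 2)

/-- Frobenius (Euclidean) norm on 3×3 matrices. -/
def mnorm (ξ : M33) : ℝ := Real.sqrt (∑ j, ∑ i, (ξ j i) ^ 2)

/-- dist(ξ,{A,B}). -/
def mdist (A B ξ : M33) : ℝ := min (mnorm (ξ - A)) (mnorm (ξ - B))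

/-- Spatial points of ℝ³ = ℝ × ℝ × ℝ. -/
abbrev Pt := ℝ × ℝ × ℝ

/-- Directional partial derivative of a map `u : ℝ³ → ℝ³`. -/
def pd (e : Pt) (u : Pt → V3) (x : Pt) : V3 := fderiv ℝ u x e

def e1 : Pt := (1, 0, 0)
def e2 : Pt := (0, 1, 0)
def e3 : Pt := (0, 0, 1)

/-- Rescaled gradient ∇_h u = (∂₁u, ∂₂u, h⁻¹ ∂₃u), as a 3×3 matrix of columns. -/
def gradh (h : ℝ) (u : Pt → V3) (x : Pt) : M33 :=
  ![pd e1 u x, pd e2 u x, h⁻¹ • pd e3 u x]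

/-- Squared rescaled Hessian |∇²_h u|². -/
def hessh (h : ℝ) (u : Pt → V3) (x : Pt) : ℝ :=
  (vnorm (pd e1 (pd e1 u) x)) ^ 2 + (vnorm (pd e2 (pd e2 u) x)) ^ 2
    + (h⁻¹) ^ 4 * (vnorm (pd e3 (pd e3 u) x)) ^ 2
    + 2 * (vnorm (pd e2 (pd e1 u) x)) ^ 2
    + 2 * (h⁻¹) ^ 2 * (vnorm (pd e3 (pd e1 u) x)) ^ 2
    + 2 * (h⁻¹) ^ 2 * (vnorm (pd e3 (pd e2 u) x)) ^ 2

/-- The energy F^h_ε(u, S) = ∫_S (1/ε) W(∇_h u) + ε |∇²_h u|², valued in [0,∞]. -/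
def F (W : M33 → ℝ) (h ε : ℝ) (u : Pt → V3) (S : Set Pt) : ℝ≥0∞ :=
  ∫⁻ x in S, ENNReal.ofReal (ε⁻¹ * W (gradh h u x) + ε * hessh h u x)

/-- Hypothesis (H1): W ≥ 0, {W = 0} = {A, B}, A ≠ B, and A' − B' = 2 a ⊗ ν̄ for
some a ∈ ℝ³ and a unit vector ν̄ ∈ ℝ². -/
def H1 (W : M33 → ℝ) (A B : M33) : Prop :=
  (∀ ξ, 0 ≤ W ξ) ∧ (∀ ξ, W ξ = 0 ↔ ξ = A ∨ ξ = B) ∧ A ≠ B ∧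
    ∃ (a : V3) (ν : ℝ × ℝ), ν.1 ^ 2 + ν.2 ^ 2 = 1 ∧
      A 0 - B 0 = (2 * ν.1) • a ∧ A 1 - B 1 = (2 * ν.2) • a

/-- Hypothesis (H2): p-growth from above and below. -/
def H2 (W : M33 → ℝ) (p : ℝ) : Prop :=
  ∃ C > (0 : ℝ), ∀ ξ, C⁻¹ * (mnorm ξ) ^ p - C ≤ W ξ ∧ W ξ ≤ C * (mnorm ξ) ^ p + C

/-- Hypothesis (H3): non-degeneracy near the wells. -/
def H3 (W : M33 → ℝ) (A B : M33) (p : ℝ) : Prop :=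
  ∃ ϱ > (0 : ℝ), ∃ C > (0 : ℝ), ∀ ξ, mdist A B ξ ≤ ϱ →
    C⁻¹ * (mdist A B ξ) ^ p ≤ W ξ ∧ W ξ ≤ C * (mdist A B ξ) ^ p

/-- Hypothesis (H4): W(ξ₁, 0, ξ₃) ≤ W(ξ). -/
def H4 (W : M33 → ℝ) : Prop := ∀ ξ : M33, W ![ξ 0, 0, ξ 2] ≤ W ξ

/-- Normalization of the wells: A = −B, first column of A is a, second column is 0. -/
def Wells (A B : M33) (a : V3) : Prop := A = -B ∧ A 0 = a ∧ A 1 = 0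

/-- ū₀(t) = |t| a. -/
def ub0 (a : V3) (t : ℝ) : V3 := |t| • a

/-- b̄₀(t) = A₃ for t ≥ 0, −A₃ (= B₃) for t < 0. -/
def bb0 (A3 : V3) (t : ℝ) : V3 := if 0 ≤ t then A3 else -A3

/-- u₀(x) = ū₀(x₁). -/
def u0 (a : V3) (x : Pt) : V3 := ub0 a x.1

/-- b₀(x) = b̄₀(x₁). -/
def b0 (A3 : V3) (x : Pt) : V3 := bb0 A3 x.1

/-- The interval I = (−1/2, 1/2). -/
def II : Set ℝ := Set.Ioo (-(1 / 2 : ℝ)) (1 / 2)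

/-- The unit cube Q = I × I × I. -/
def Q3 : Set Pt := II ×ˢ (II ×ˢ II)

/-- J_ρ = (ρ I) × J × I. -/
def Jrho (J : Set ℝ) (ρ : ℝ) : Set Pt := (Set.Ioo (-(ρ / 2)) (ρ / 2)) ×ˢ (J ×ˢ II)

/-- The rescaled thin domain Ω = ω × I. -/
def Om (ω : Set (ℝ × ℝ)) : Set Pt := {x | (x.1, x.2.1) ∈ ω ∧ x.2.2 ∈ II}

/-- L¹ convergence on a set U. -/
def TendsL1 (U : Set Pt) (f : ℕ → Pt → V3) (g : Pt → V3) : Prop :=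
  Tendsto (fun n => ∫⁻ x in U, ENNReal.ofReal (vnorm (f n x - g x))) atTop (nhds 0)

/-- L^q convergence on a set U. -/
def TendsLp (U : Set Pt) (q : ℝ) (f : ℕ → Pt → V3) (g : Pt → V3) : Prop :=
  Tendsto (fun n => ∫⁻ x in U, ENNReal.ofReal ((vnorm (f n x - g x)) ^ q)) atTop (nhds 0)

/-- The localized asymptotic energy 𝓔_γ(J, ρ). -/
def Egam (W : M33 → ℝ) (a A3 : V3) (γ : ℝ) (J : Set ℝ) (ρ : ℝ) : ℝ≥0∞ :=
  sInf { L : ℝ≥0∞ | ∃ (h ε : ℕ → ℝ) (u : ℕ → Pt → V3),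
    (∀ n, 0 < h n) ∧ (∀ n, 0 < ε n) ∧
    Tendsto h atTop (nhds 0) ∧ Tendsto ε atTop (nhds 0) ∧
    Tendsto (fun n => h n / ε n) atTop (nhds γ) ∧
    (∀ n, ContDiffOn ℝ 2 (u n) (Jrho J ρ)) ∧
    TendsL1 (Jrho J ρ) u (u0 a) ∧
    TendsL1 (Jrho J ρ) (fun n x => (h n)⁻¹ • pd e3 (u n) x) (b0 A3) ∧
    L = Filter.liminf (fun n => F W (h n) (ε n) (u n) (Jrho J ρ)) atTop }

/-- K*_γ = 𝓔_γ(I, 1). -/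
def Kstar (W : M33 → ℝ) (a A3 : V3) (γ : ℝ) : ℝ≥0∞ := Egam W a A3 γ II 1

/-- K*_∞ : the analogue of K*_γ for h/ε → ∞, on the unit cube Q. -/
def KstarInf (W : M33 → ℝ) (a A3 : V3) : ℝ≥0∞ :=
  sInf { L : ℝ≥0∞ | ∃ (h ε : ℕ → ℝ) (u : ℕ → Pt → V3),
    (∀ n, 0 < h n) ∧ (∀ n, 0 < ε n) ∧
    Tendsto h atTop (nhds 0) ∧ Tendsto ε atTop (nhds 0) ∧
    Tendsto (fun n => h n / ε n) atTop atTop ∧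
    (∀ n, ContDiffOn ℝ 2 (u n) Q3) ∧
    TendsL1 Q3 u (u0 a) ∧
    TendsL1 Q3 (fun n x => (h n)⁻¹ • pd e3 (u n) x) (b0 A3) ∧
    L = Filter.liminf (fun n => F W (h n) (ε n) (u n) Q3) atTop }

open Classical in
/-- The phase matrix: B on E, A off E. -/
def Mfun (A B : M33) (E : Set (ℝ × ℝ)) (x' : ℝ × ℝ) : M33 := if x' ∈ E then B else A

/-! ### Two-dimensional objects -/

abbrev Pt2 := ℝ × ℝ

/-- Directional partial derivative of a map `v : ℝ² → ℝ³`. -/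
def qd (e : Pt2) (v : Pt2 → V3) (y : Pt2) : V3 := fderiv ℝ v y e

def f1 : Pt2 := (1, 0)
def f2 : Pt2 := (0, 1)

/-- 𝒲(∇v) = W(∂₁v, 0, ∂₂v). -/
def W2 (W : M33 → ℝ) (v : Pt2 → V3) (y : Pt2) : ℝ := W ![qd f1 v y, 0, qd f2 v y]

/-- Squared 2D Hessian |∇²v|². -/
def hess2d (v : Pt2 → V3) (y : Pt2) : ℝ :=
  (vnorm (qd f1 (qd f1 v) y)) ^ 2 + 2 * (vnorm (qd f2 (qd f1 v) y)) ^ 2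
    + (vnorm (qd f2 (qd f2 v) y)) ^ 2

/-- The rectangle ℓI × γI. -/
def Rect (ℓ γ : ℝ) : Set Pt2 := Set.Ioo (-(ℓ / 2)) (ℓ / 2) ×ˢ Set.Ioo (-(γ / 2)) (γ / 2)

/-- The optimal-profile constant K_γ of the critical regime. -/
def Kgam (W : M33 → ℝ) (a A3 : V3) (γ : ℝ) : ℝ≥0∞ :=
  sInf { L : ℝ≥0∞ | ∃ ℓ > (0 : ℝ), ∃ v : Pt2 → V3,
    ContDiffOn ℝ 2 v (Rect ℓ γ) ∧
    (∃ δ > (0 : ℝ), ∀ y ∈ Rect ℓ γ, ℓ / 2 - δ < y.1 → qd f1 v y = a ∧ qd f2 v y = A3) ∧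
    (∃ δ > (0 : ℝ), ∀ y ∈ Rect ℓ γ, y.1 < -(ℓ / 2) + δ → qd f1 v y = -a ∧ qd f2 v y = -A3) ∧
    L = ENNReal.ofReal γ⁻¹ *
      ∫⁻ y in Rect ℓ γ, ENNReal.ofReal (W2 W v y + hess2d v y) }

/-- The 2D subcritical functional F⁰_ε(u, b, D). -/
def F0 (W : M33 → ℝ) (ε : ℝ) (u b : Pt2 → V3) (D : Set Pt2) : ℝ≥0∞ :=
  ∫⁻ y in D, ENNReal.ofReal (ε⁻¹ * W ![qd f1 u y, qd f2 u y, b y]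
    + ε * ((vnorm (qd f1 (qd f1 u) y)) ^ 2 + 2 * (vnorm (qd f2 (qd f1 u) y)) ^ 2
      + (vnorm (qd f2 (qd f2 u) y)) ^ 2
      + 2 * (vnorm (qd f1 b y)) ^ 2 + 2 * (vnorm (qd f2 b y)) ^ 2))

/-- K*₀: the subcritical cell constant. -/
def Kstar0 (W : M33 → ℝ) (a A3 : V3) : ℝ≥0∞ :=
  sInf { L : ℝ≥0∞ | ∃ (ε : ℕ → ℝ) (u b : ℕ → Pt2 → V3),
    (∀ n, 0 < ε n) ∧ Tendsto ε atTop (nhds 0) ∧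
    (∀ n, ContDiffOn ℝ 2 (u n) (II ×ˢ II)) ∧ (∀ n, ContDiffOn ℝ 1 (b n) (II ×ˢ II)) ∧
    Tendsto (fun n => ∫⁻ y in II ×ˢ II,
      ENNReal.ofReal (vnorm (u n y - ub0 a y.1) + vnorm (b n y - bb0 A3 y.1)))
      atTop (nhds 0) ∧
    L = Filter.liminf (fun n => F0 W (ε n) (u n) (b n) (II ×ˢ II)) atTop }

/-- K₀: the subcritical optimal-profile constant. -/
def K0 (W : M33 → ℝ) (a A3 : V3) : ℝ≥0∞ :=
  sInf { L : ℝ≥0∞ | ∃ ℓ > (0 : ℝ), ∃ φ1 φ2 : ℝ → V3,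
    ContDiffOn ℝ 1 φ1 (Set.Icc (-ℓ) ℓ) ∧ ContDiffOn ℝ 1 φ2 (Set.Icc (-ℓ) ℓ) ∧
    φ1 ℓ = a ∧ φ2 ℓ = A3 ∧ φ1 (-ℓ) = -a ∧ φ2 (-ℓ) = -A3 ∧
    L = ∫⁻ t in Set.Ioo (-ℓ) ℓ, ENNReal.ofReal (W ![φ1 t, 0, φ2 t]
      + (vnorm (derivWithin φ1 (Set.Icc (-ℓ) ℓ) t)) ^ 2
      + 2 * (vnorm (derivWithin φ2 (Set.Icc (-ℓ) ℓ) t)) ^ 2) }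

/-- K_∞ in the case λ = 0. -/
def KinfZero (W : M33 → ℝ) (a : V3) : ℝ≥0∞ :=
  sInf { L : ℝ≥0∞ | ∃ ℓ > (0 : ℝ), ∃ v : Pt2 → V3,
    ContDiff ℝ 2 v ∧ (∀ y : Pt2, v (y.1, y.2 + 1) = v y) ∧
    (∃ δ > (0 : ℝ), ∀ y : Pt2, |y.1 - 1 / 2| < δ → qd f1 v y = a ∧ qd f2 v y = 0) ∧
    (∃ δ > (0 : ℝ), ∀ y : Pt2, |y.1 + 1 / 2| < δ → qd f1 v y = -a ∧ qd f2 v y = 0) ∧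
    L = ∫⁻ y in II ×ˢ II, ENNReal.ofReal (ℓ * W2 W v y + ℓ⁻¹ * hess2d v y) }

/-- The unit normal ν_λ = (1+λ²)^{-1/2} (1, λ). -/
def nuv (lam : ℝ) : Pt2 := (1 / Real.sqrt (1 + lam ^ 2), lam / Real.sqrt (1 + lam ^ 2))

/-- The orthogonal direction ν_λ^⊥ = (1+λ²)^{-1/2} (−λ, 1). -/
def nupv (lam : ℝ) : Pt2 := (-lam / Real.sqrt (1 + lam ^ 2), 1 / Real.sqrt (1 + lam ^ 2))

/-- Dot product on ℝ². -/
def dotp (w y : Pt2) : ℝ := w.1 * y.1 + w.2 * y.2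

/-- The unit square Q'_λ centered at 0 with two sides orthogonal to ν_λ. -/
def Qlam (lam : ℝ) : Set Pt2 := {y | |dotp (nuv lam) y| < 1 / 2 ∧ |dotp (nupv lam) y| < 1 / 2}

/-- K_∞ for general λ. -/
def KinfL (W : M33 → ℝ) (a : V3) (lam : ℝ) : ℝ≥0∞ :=
  ENNReal.ofReal (Real.sqrt (1 + lam ^ 2)) *
    sInf { L : ℝ≥0∞ | ∃ ℓ > (0 : ℝ), ∃ v : Pt2 → V3,
      ContDiff ℝ 2 v ∧ (∀ y : Pt2, v (y + nupv lam) = v y) ∧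
      (∃ δ > (0 : ℝ), ∀ y : Pt2, |dotp (nuv lam) y - 1 / 2| < δ →
        qd f1 v y = a ∧ qd f2 v y = lam • a) ∧
      (∃ δ > (0 : ℝ), ∀ y : Pt2, |dotp (nuv lam) y + 1 / 2| < δ →
        qd f1 v y = -a ∧ qd f2 v y = -(lam • a)) ∧
      L = ∫⁻ y in Qlam lam, ENNReal.ofReal (ℓ * W2 W v y + ℓ⁻¹ * hess2d v y) }

/-- Number of interfaces strictly below t. -/
def cnt (m : ℕ) (α : Fin m → ℝ) (t : ℝ) : ℕ := (Finset.univ.filter (fun i => α i < t)).card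

end

/-- Diagonal extraction in a first-countable space. -/
theorem exists_diagonal_tendsto {X : Type*} [TopologicalSpace X] [FirstCountableTopology X]
    (f : ℕ → ℕ → X) (y : ℕ → X) (x : X) (hf : ∀ k, Tendsto (f k) atTop (𝓝 (y k)))
    (hy : Tendsto y atTop (𝓝 x)) :
    ∃ φ : ℕ → ℕ, Tendsto (fun n => f (φ n) n) atTop (𝓝 x) := by
  classical
  obtain ⟨U, hU⟩ := (𝓝 x).exists_antitone_basis
  have hk : ∀ j, ∃ k, ∀ᶠ n in atTop, f k n ∈ U j := by
    intro j
    have hUj : interior (U j) ∈ 𝓝 x := interior_mem_nhds.2 (hU.1.mem_of_mem trivial)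
    obtain ⟨k, hk⟩ := (hy.eventually hUj).exists
    refine ⟨k, (hf k).eventually ?_⟩
    exact mem_of_superset (isOpen_interior.mem_nhds hk) interior_subset
  choose k hk using hk
  let P : ℕ → ℕ → Prop := fun n j => ∀ n' ≥ n, f (k j) n' ∈ U j
  refine ⟨fun n => k (Nat.findGreatest (P n) n), ?_⟩
  rw [hU.1.tendsto_right_iff]
  intro j _
  obtain ⟨N, hN⟩ := eventually_atTop.1 (hk j)
  filter_upwards [eventually_ge_atTop (max j N)] with n hn
  have hPj : P n j := fun n' hn' => hN n' (le_trans (le_trans (le_max_right _ _) hn) hn')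
  have hjn : j ≤ n := le_trans (le_max_left _ _) hn
  have h1 : P n (Nat.findGreatest (P n) n) := Nat.findGreatest_spec hjn hPj
  have h2 : j ≤ Nat.findGreatest (P n) n := Nat.le_findGreatest hjn hPj
  exact hU.2 h2 (h1 n le_rfl)

/-! ### The Euclidean norm -/

theorem continuous_vnorm : Continuous vnorm := by
  unfold vnorm; fun_prop

theorem vnorm_nonneg (v : V3) : 0 ≤ vnorm v := Real.sqrt_nonneg _

@[simp] theorem vnorm_zero : vnorm 0 = 0 := by simp [vnorm]

theorem vnorm_smul_sq (c : ℝ) (v : V3) : vnorm (c • v) ^ 2 = c ^ 2 * vnorm v ^ 2 := by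
  unfold vnorm
  rw [Real.sq_sqrt (by positivity), Real.sq_sqrt (by positivity), Finset.mul_sum]
  simp [mul_pow]

theorem vnorm_le (v : V3) : vnorm v ≤ 2 * ‖v‖ := by
  unfold vnorm
  rw [Real.sqrt_le_left (by positivity)]
  have h : ∀ i, v i ^ 2 ≤ ‖v‖ ^ 2 := fun i => by
    have := norm_le_pi_norm v i
    rw [← sq_abs]; exact pow_le_pow_left₀ (abs_nonneg _) this 2
  rw [Fin.sum_univ_three]
  nlinarith [h 0, h 1, h 2, sq_nonneg ‖v‖]

/-! ### Partial derivatives in the plane and the energy density -/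

theorem contDiff_qd {n m : WithTop ℕ∞} {v : Pt2 → V3} (hv : ContDiff ℝ n v) (hmn : m + 1 ≤ n)
    (e : Pt2) : ContDiff ℝ m (qd e v) :=
  (hv.fderiv_right hmn).clm_apply contDiff_const

theorem contDiff_qd_one {v : Pt2 → V3} (hv : ContDiff ℝ 2 v) (e : Pt2) : ContDiff ℝ 1 (qd e v) :=
  contDiff_qd hv (by norm_num [one_add_one_eq_two]) e

theorem continuous_qd_qd {v : Pt2 → V3} (hv : ContDiff ℝ 2 v) (e e' : Pt2) :
    Continuous (qd e (qd e' v)) :=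
  (contDiff_qd (m := 0) (contDiff_qd_one hv e') (by norm_num) e).continuous

/-- The planar energy density `𝒲(∇v) + |∇²v|²`. -/
noncomputable def dens (W : M33 → ℝ) (v : Pt2 → V3) (y : Pt2) : ℝ := W2 W v y + hess2d v y

theorem continuous_dens {W : M33 → ℝ} (hW : Continuous W) {v : Pt2 → V3} (hv : ContDiff ℝ 2 v) :
    Continuous (dens W v) := by
  have h1 : Continuous (qd f1 v) := (contDiff_qd_one hv f1).continuous
  have h2 : Continuous (qd f2 v) := (contDiff_qd_one hv f2).continuous
  have hM : Continuous fun y => (![qd f1 v y, 0, qd f2 v y] : M33) := by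
    refine continuous_pi fun i => ?_
    fin_cases i
    · exact h1
    · exact continuous_const
    · exact h2
  have h11 := continuous_vnorm.comp (continuous_qd_qd hv f1 f1)
  have h21 := continuous_vnorm.comp (continuous_qd_qd hv f2 f1)
  have h22 := continuous_vnorm.comp (continuous_qd_qd hv f2 f2)
  unfold dens W2 hess2d
  exact (hW.comp hM).add (((h11.pow 2).add ((h21.pow 2).const_mul 2)).add (h22.pow 2))

theorem hess2d_nonneg (v : Pt2 → V3) (y : Pt2) : 0 ≤ hess2d v y := by
  unfold hess2d; positivity

theorem dens_nonneg {W : M33 → ℝ} (hW : ∀ ξ, 0 ≤ W ξ) (v : Pt2 → V3) (y : Pt2) :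
    0 ≤ dens W v y := add_nonneg (hW _) (hess2d_nonneg v y)

theorem qd_congr {v w : Pt2 → V3} {y : Pt2} (hvw : v =ᶠ[𝓝 y] w) (e : Pt2) :
    qd e v =ᶠ[𝓝 y] qd e w := by
  filter_upwards [hvw.eventuallyEq_nhds] with z hz
  unfold qd; rw [hz.fderiv_eq]

theorem dens_congr {W : M33 → ℝ} {v w : Pt2 → V3} {y : Pt2} (hvw : v =ᶠ[𝓝 y] w) :
    dens W v y = dens W w y := by
  have h1 := qd_congr hvw f1
  have h2 := qd_congr hvw f2
  unfold dens W2 hess2d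
  rw [h1.eq_of_nhds, h2.eq_of_nhds, (qd_congr h1 f1).eq_of_nhds, (qd_congr h1 f2).eq_of_nhds,
    (qd_congr h2 f2).eq_of_nhds]

theorem qd_eq_zero_of_eventuallyEq_const {q : Pt2 → V3} {y : Pt2} {c : V3}
    (h : q =ᶠ[𝓝 y] fun _ => c) (e : Pt2) : qd e q y = 0 := by
  unfold qd; rw [h.fderiv_eq]; simp

/-! ### Profiles -/

/-- On the strip `|y₂| < Γ/2`, `q` equals `c` to the right of `L` and `-c` to the left of `-L`. -/
def TailOn (q : Pt2 → V3) (c : V3) (L Γ : ℝ) : Prop :=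
  ∀ y : Pt2, |y.2| < Γ / 2 → (L < y.1 → q y = c) ∧ (y.1 < -L → q y = -c)

/-- A global `C²` transition profile between the gradients `∓(a, A₃)` on the strip of width `Γ`. -/
structure IsProfile (a A3 : V3) (L Γ : ℝ) (w : Pt2 → V3) : Prop where
  contDiff : ContDiff ℝ 2 w
  pos : 0 < L
  tail1 : TailOn (qd f1 w) a L Γ
  tail2 : TailOn (qd f2 w) A3 L Γ

theorem isOpen_right (L Γ : ℝ) : IsOpen {y : Pt2 | L < y.1 ∧ |y.2| < Γ / 2} :=
  (isOpen_lt continuous_const continuous_fst).inter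
    (isOpen_lt continuous_snd.abs continuous_const)

theorem isOpen_left (L Γ : ℝ) : IsOpen {y : Pt2 | y.1 < -L ∧ |y.2| < Γ / 2} :=
  (isOpen_lt continuous_fst continuous_const).inter
    (isOpen_lt continuous_snd.abs continuous_const)

theorem TailOn.qd_eq_zero {q : Pt2 → V3} {c : V3} {L Γ : ℝ} (hq : TailOn q c L Γ) {y : Pt2}
    (hy : |y.2| < Γ / 2) (hL : L < |y.1|) (e : Pt2) : qd e q y = 0 := by
  rcases lt_abs.1 hL with h | h
  · refine qd_eq_zero_of_eventuallyEq_const (c := c) ?_ e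
    filter_upwards [(isOpen_right L Γ).mem_nhds (x := y) ⟨h, hy⟩] with z hz
    exact (hq z hz.2).1 hz.1
  · refine qd_eq_zero_of_eventuallyEq_const (c := -c) ?_ e
    filter_upwards [(isOpen_left L Γ).mem_nhds (x := y) ⟨by linarith, hy⟩] with z hz
    exact (hq z hz.2).2 hz.1

theorem IsProfile.hess_eq_zero {a A3 : V3} {L Γ : ℝ} {w : Pt2 → V3} (hw : IsProfile a A3 L Γ w)
    {y : Pt2} (hy : |y.2| < Γ / 2) (hL : L < |y.1|) : hess2d w y = 0 := by
  unfold hess2d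
  rw [hw.tail1.qd_eq_zero hy hL, hw.tail1.qd_eq_zero hy hL, hw.tail2.qd_eq_zero hy hL]
  simp

theorem IsProfile.dens_eq_zero {W : M33 → ℝ} {a A3 : V3} {L Γ : ℝ} {w : Pt2 → V3}
    (hw : IsProfile a A3 L Γ w) (hp : W ![a, 0, A3] = 0) (hm : W ![-a, 0, -A3] = 0)
    {y : Pt2} (hy : |y.2| < Γ / 2) (hL : L < |y.1|) : dens W w y = 0 := by
  unfold dens
  rw [hw.hess_eq_zero hy hL, add_zero]
  unfold W2
  rcases lt_abs.1 hL with h | h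
  · rw [(hw.tail1 y hy).1 h, (hw.tail2 y hy).1 h, hp]
  · rw [(hw.tail1 y hy).2 (by linarith), (hw.tail2 y hy).2 (by linarith), hm]

/-- The energy of a profile per unit length of interface. -/
noncomputable def energy (W : M33 → ℝ) (γ : ℝ) (w : Pt2 → V3) : ℝ≥0∞ :=
  ENNReal.ofReal γ⁻¹ *
    ∫⁻ y in (univ : Set ℝ) ×ˢ Ioo (-(γ / 2)) (γ / 2), ENNReal.ofReal (dens W w y)

theorem Kgam_le_energy {W : M33 → ℝ} {a A3 : V3} {L Γ γ : ℝ} {w : Pt2 → V3}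
    (hw : IsProfile a A3 L Γ w) (hγΓ : γ ≤ Γ) : Kgam W a A3 γ ≤ energy W γ w := by
  have hL := hw.pos
  have key : ∀ y ∈ Rect (2 * L + 2) γ, |y.2| < Γ / 2 := fun y hy =>
    lt_of_lt_of_le (abs_lt.2 hy.2) (by linarith)
  refine le_trans (sInf_le ⟨2 * L + 2, by linarith, w, hw.contDiff.contDiffOn, ⟨1, one_pos, ?_⟩,
    ⟨1, one_pos, ?_⟩, rfl⟩) ?_
  · intro y hy h
    exact ⟨(hw.tail1 y (key y hy)).1 (by linarith), (hw.tail2 y (key y hy)).1 (by linarith)⟩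
  · intro y hy h
    exact ⟨(hw.tail1 y (key y hy)).2 (by linarith), (hw.tail2 y (key y hy)).2 (by linarith)⟩
  · unfold energy
    refine mul_le_mul_right (lintegral_mono_set ?_) _
    exact prod_mono (subset_univ _) subset_rfl

/-! ### Smooth truncations -/

/-- A smooth function equal to `t` for `t ≤ p`, with values in `[p, q)` for `t ≥ p`. -/
noncomputable def clampR (p q t : ℝ) : ℝ := t + (p - t) * Real.smoothTransition ((t - p) / (q - p))

theorem contDiff_clampR (p q : ℝ) : ContDiff ℝ 2 (clampR p q) := by
  have h : ContDiff ℝ 2 Real.smoothTransition := Real.smoothTransition.contDiff (n := 2)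
  unfold clampR
  exact contDiff_id.add ((contDiff_const.sub contDiff_id).mul
    (h.comp ((contDiff_id.sub contDiff_const).div_const _)))

theorem clampR_of_le {p q t : ℝ} (hpq : p < q) (ht : t ≤ p) : clampR p q t = t := by
  unfold clampR
  rw [Real.smoothTransition.zero_of_nonpos]
  · ring
  · exact div_nonpos_of_nonpos_of_nonneg (by linarith) (by linarith)

theorem clampR_mem {p q t : ℝ} (hpq : p < q) (ht : p ≤ t) :
    p ≤ clampR p q t ∧ clampR p q t < q := by
  unfold clampR
  have h0 := Real.smoothTransition.nonneg ((t - p) / (q - p))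
  have h1 := Real.smoothTransition.le_one ((t - p) / (q - p))
  refine ⟨by nlinarith, ?_⟩
  rcases lt_or_ge t q with h | h
  · nlinarith
  · rw [Real.smoothTransition.one_of_one_le]
    · linarith
    · rw [le_div_iff₀ (by linarith)]; linarith

/-- A smooth function equal to `t` for `|t| ≤ p`, with values in `(-q, q)`. -/
noncomputable def clamp (p q t : ℝ) : ℝ := -clampR p q (-clampR p q t)

theorem contDiff_clamp (p q : ℝ) : ContDiff ℝ 2 (clamp p q) :=
  ((contDiff_clampR p q).comp (contDiff_clampR p q).neg).neg

theorem clamp_of_gt {p q t : ℝ} (hp : 0 < p) (hpq : p < q) (ht : -p < t) :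
    clamp p q t = clampR p q t := by
  unfold clamp
  rw [clampR_of_le hpq, neg_neg]
  rcases le_total t p with h | h
  · rw [clampR_of_le hpq h]; linarith
  · linarith [(clampR_mem hpq h).1]

theorem clamp_of_lt {p q t : ℝ} (hpq : p < q) (ht : t < p) :
    clamp p q t = -clampR p q (-t) := by
  unfold clamp
  rw [clampR_of_le hpq ht.le]

theorem clamp_of_abs_lt {p q t : ℝ} (hpq : p < q) (ht : |t| < p) :
    clamp p q t = t := by
  rw [abs_lt] at ht
  rw [clamp_of_lt hpq ht.2, clampR_of_le hpq (by linarith), neg_neg]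

theorem clamp_mem {p q : ℝ} (hp : 0 < p) (hpq : p < q) (t : ℝ) : clamp p q t ∈ Ioo (-q) q := by
  rcases lt_or_ge (-p) t with h | h
  · rw [clamp_of_gt hp hpq h]
    rcases le_total t p with h' | h'
    · rw [clampR_of_le hpq h']; exact ⟨by linarith, by linarith⟩
    · have := clampR_mem hpq h'
      exact ⟨by linarith, this.2⟩
  · rw [clamp_of_lt hpq (by linarith)]
    have := clampR_mem hpq (show p ≤ -t by linarith)
    exact ⟨by linarith, by linarith⟩

theorem le_clamp {p q L t : ℝ} (hp : 0 < p) (hpq : p < q) (hL : -p < L) (hLp : L < p)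
    (ht : L < t) : L < clamp p q t := by
  rw [clamp_of_gt hp hpq (by linarith)]
  rcases le_total t p with h' | h'
  · rwa [clampR_of_le hpq h']
  · linarith [(clampR_mem hpq h').1]

theorem clamp_le {p q L t : ℝ} (hpq : p < q) (hL : -p < L) (hLp : L < p)
    (ht : t < -L) : clamp p q t < -L := by
  rw [clamp_of_lt hpq (by linarith)]
  rcases le_total (-t) p with h' | h'
  · rw [clampR_of_le hpq h']; linarith
  · linarith [(clampR_mem hpq h').1]

/-- The smooth function `|t| - |clamp t|`. -/
noncomputable def clampRest (p q t : ℝ) : ℝ := -clampR p q t - clampR p q (-t)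

theorem contDiff_clampRest (p q : ℝ) : ContDiff ℝ 2 (clampRest p q) :=
  (contDiff_clampR p q).neg.sub ((contDiff_clampR p q).comp contDiff_neg)

theorem clampRest_of_gt {p q t : ℝ} (hp : 0 < p) (hpq : p < q) (ht : -p < t) :
    clampRest p q t = t - clamp p q t := by
  rw [clamp_of_gt hp hpq ht, clampRest, clampR_of_le hpq (show -t ≤ p by linarith)]; ring

theorem clampRest_of_lt {p q t : ℝ} (hpq : p < q) (ht : t < p) :
    clampRest p q t = clamp p q t - t := by
  rw [clamp_of_lt hpq ht, clampRest, clampR_of_le hpq ht.le]; ring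

theorem clampRest_of_abs_lt {p q t : ℝ} (hpq : p < q) (ht : |t| < p) :
    clampRest p q t = 0 := by
  rw [clampRest_of_lt hpq (abs_lt.1 ht).2, clamp_of_abs_lt hpq ht, sub_self]

theorem deriv_clampRest_of_gt {p q t : ℝ} (hp : 0 < p) (hpq : p < q) (ht : -p < t) :
    deriv (clampRest p q) t = 1 - deriv (clamp p q) t := by
  have h : clampRest p q =ᶠ[𝓝 t] fun t => t - clamp p q t := by
    filter_upwards [lt_mem_nhds ht] with z hz using clampRest_of_gt hp hpq hz
  rw [h.deriv_eq, deriv_fun_sub differentiableAt_fun_id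
    ((contDiff_clamp p q).differentiable (by norm_num) t)]
  simp

theorem deriv_clampRest_of_lt {p q t : ℝ} (hpq : p < q) (ht : t < p) :
    deriv (clampRest p q) t = deriv (clamp p q) t - 1 := by
  have h : clampRest p q =ᶠ[𝓝 t] fun t => clamp p q t - t := by
    filter_upwards [gt_mem_nhds ht] with z hz using clampRest_of_lt hpq hz
  rw [h.deriv_eq, deriv_fun_sub
    ((contDiff_clamp p q).differentiable (by norm_num) t) differentiableAt_fun_id]
  simp

theorem deriv_clamp_of_abs_lt {p q t : ℝ} (hpq : p < q) (ht : |t| < p) :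
    deriv (clamp p q) t = 1 := by
  have h : clamp p q =ᶠ[𝓝 t] fun t => t := by
    filter_upwards [(isOpen_lt continuous_abs continuous_const).mem_nhds ht] with z hz
      using clamp_of_abs_lt hpq hz
  rw [h.deriv_eq]; simp

/-! ### Extension of admissible maps to profiles -/

theorem isOpen_Rect (ℓ γ : ℝ) : IsOpen (Rect ℓ γ) := isOpen_Ioo.prod isOpen_Ioo

/-- A map on a rectangle with affine ends extends to a global profile, after truncation in the
vertical variable. -/
theorem exists_profile_extension {W : M33 → ℝ} {a A3 : V3} (hp : W ![a, 0, A3] = 0)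
    (hm : W ![-a, 0, -A3] = 0) {ℓ γ : ℝ} (hℓ : 0 < ℓ) {v : Pt2 → V3}
    (hv : ContDiffOn ℝ 2 v (Rect ℓ γ))
    (hr : ∃ δ > (0 : ℝ), ∀ y ∈ Rect ℓ γ, ℓ / 2 - δ < y.1 → qd f1 v y = a ∧ qd f2 v y = A3)
    (hl : ∃ δ > (0 : ℝ), ∀ y ∈ Rect ℓ γ, y.1 < -(ℓ / 2) + δ → qd f1 v y = -a ∧ qd f2 v y = -A3)
    {Γ : ℝ} (hΓ : 0 < Γ) (hΓγ : Γ < γ) :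
    ∃ w L, IsProfile a A3 L Γ w ∧
      ∫⁻ y in (univ : Set ℝ) ×ˢ Ioo (-(Γ / 2)) (Γ / 2), ENNReal.ofReal (dens W w y) ≤
        ∫⁻ y in Rect ℓ γ, ENNReal.ofReal (dens W v y) := by
  obtain ⟨δ1, hδ1, hr⟩ := hr
  obtain ⟨δ2, hδ2, hl⟩ := hl
  obtain ⟨L, hL0, hL1, hL2, hLℓ⟩ : ∃ L, 0 < L ∧ ℓ / 2 - δ1 < L ∧ ℓ / 2 - δ2 < L ∧ L < ℓ / 2 := by
    refine ⟨ℓ / 2 - min (min δ1 δ2) (ℓ / 2) / 2, ?_, ?_, ?_, ?_⟩ <;>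
    have h1 := min_le_left (min δ1 δ2) (ℓ / 2) <;>
    have h2 := min_le_right (min δ1 δ2) (ℓ / 2) <;>
    have h3 := min_le_left δ1 δ2 <;>
    have h4 := min_le_right δ1 δ2 <;>
    have h5 : 0 < min (min δ1 δ2) (ℓ / 2) := by positivity
    all_goals linarith
  obtain ⟨P, hLP, hPℓ⟩ := exists_between hLℓ
  have hP : 0 < P := by linarith
  set θ := clamp P (ℓ / 2) with hθ
  set τ := clamp (Γ / 2) (γ / 2) with hτ
  set r := clampRest P (ℓ / 2) with hr'
  set Θ : Pt2 → Pt2 := fun y => (θ y.1, τ y.2) with hΘ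
  have hΘmem : ∀ y, Θ y ∈ Rect ℓ γ := fun y =>
    ⟨clamp_mem hP hPℓ _, clamp_mem (by linarith) (by linarith) _⟩
  have hΘC : ContDiff ℝ 2 Θ :=
    ((contDiff_clamp _ _).comp contDiff_fst).prodMk ((contDiff_clamp _ _).comp contDiff_snd)
  set w : Pt2 → V3 := fun y => v (Θ y) + r y.1 • a with hw
  have hwC : ContDiff ℝ 2 w := by
    refine ContDiff.add ?_ (((contDiff_clampRest _ _).comp contDiff_fst).smul contDiff_const)
    rw [contDiff_iff_contDiffAt]
    intro y
    exact ((hv.contDiffAt ((isOpen_Rect ℓ γ).mem_nhds (hΘmem y)))).comp y hΘC.contDiffAt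
  have hd : ∀ y e, qd e w y =
      fderiv ℝ v (Θ y) (deriv θ y.1 * e.1, deriv τ y.2 * e.2) + (deriv r y.1 * e.1) • a := by
    intro y e
    have hvd : HasFDerivAt v (fderiv ℝ v (Θ y)) (Θ y) :=
      ((hv.contDiffAt ((isOpen_Rect ℓ γ).mem_nhds (hΘmem y))).differentiableAt
        (by norm_num)).hasFDerivAt
    have h1 : HasDerivAt θ (deriv θ y.1) y.1 :=
      ((contDiff_clamp _ _).differentiable (by norm_num) _).hasDerivAt
    have h2 : HasDerivAt τ (deriv τ y.2) y.2 :=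
      ((contDiff_clamp _ _).differentiable (by norm_num) _).hasDerivAt
    have h3 : HasDerivAt r (deriv r y.1) y.1 :=
      ((contDiff_clampRest _ _).differentiable (by norm_num) _).hasDerivAt
    have hf : HasFDerivAt (fun y : Pt2 => y.1) (ContinuousLinearMap.fst ℝ ℝ ℝ) y := hasFDerivAt_fst
    have hs : HasFDerivAt (fun y : Pt2 => y.2) (ContinuousLinearMap.snd ℝ ℝ ℝ) y := hasFDerivAt_snd
    have h4 := (h1.comp_hasFDerivAt y hf).prodMk (h2.comp_hasFDerivAt y hs)
    have h5 := (hvd.comp y h4).add ((h3.comp_hasFDerivAt y hf).smul_const a)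
    have h6 : HasFDerivAt w _ y := h5
    unfold qd
    rw [h6.fderiv]
    simp
  have hd1 : ∀ y, qd f1 w y = deriv θ y.1 • qd f1 v (Θ y) + deriv r y.1 • a := by
    intro y
    rw [hd, qd, ← (fderiv ℝ v (Θ y)).map_smul]
    simp [f1]
  have hd2 : ∀ y : Pt2, |y.2| < Γ / 2 → qd f2 w y = qd f2 v (Θ y) := by
    intro y hy
    rw [hd, deriv_clamp_of_abs_lt (by linarith) hy]
    simp [f2, qd]
  have hwP : IsProfile a A3 L Γ w := by
    refine ⟨hwC, hL0, fun y hy => ⟨fun h => ?_, fun h => ?_⟩,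
      fun y hy => ⟨fun h => ?_, fun h => ?_⟩⟩
    · have h' : L < θ y.1 := le_clamp hP hPℓ (by linarith) hLP h
      rw [hd1, (hr _ (hΘmem y) (by simp only [hΘ]; linarith)).1,
        deriv_clampRest_of_gt hP hPℓ (by linarith)]
      module
    · have h' : θ y.1 < -L := clamp_le hPℓ (by linarith) hLP h
      rw [hd1, (hl _ (hΘmem y) (by simp only [hΘ]; linarith)).1,
        deriv_clampRest_of_lt hPℓ (by linarith)]
      module
    · have h' : L < θ y.1 := le_clamp hP hPℓ (by linarith) hLP h
      rw [hd2 y hy, (hr _ (hΘmem y) (by simp only [hΘ]; linarith)).2]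
    · have h' : θ y.1 < -L := clamp_le hPℓ (by linarith) hLP h
      rw [hd2 y hy, (hl _ (hΘmem y) (by simp only [hΘ]; linarith)).2]
  refine ⟨w, L, hwP, ?_⟩
  rw [← lintegral_indicator (MeasurableSet.univ.prod measurableSet_Ioo),
    ← lintegral_indicator (isOpen_Rect ℓ γ).measurableSet]
  refine lintegral_mono fun y => ?_
  by_cases hy : |y.2| < Γ / 2
  · by_cases hy1 : |y.1| < P
    · have hyR : y ∈ Rect ℓ γ :=
        ⟨abs_lt.1 (hy1.trans hPℓ), abs_lt.1 (hy.trans (by linarith))⟩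
      have hloc : w =ᶠ[𝓝 y] v := by
        have ho : IsOpen {z : Pt2 | |z.1| < P ∧ |z.2| < Γ / 2} :=
          (isOpen_lt continuous_fst.abs continuous_const).inter
            (isOpen_lt continuous_snd.abs continuous_const)
        filter_upwards [ho.mem_nhds (x := y) ⟨hy1, hy⟩] with z hz
        simp only [hw, hΘ, hθ, hτ, hr']
        rw [clampRest_of_abs_lt hPℓ hz.1, clamp_of_abs_lt hPℓ hz.1,
          clamp_of_abs_lt (by linarith) hz.2]
        simp
      rw [indicator_of_mem hyR, ← dens_congr hloc]
      exact indicator_le_self _ _ _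
    · refine (indicator_le_self _ _ _).trans ?_
      rw [hwP.dens_eq_zero hp hm hy (by linarith)]
      simp
  · rw [indicator_of_notMem]
    · exact zero_le
    · exact fun h => hy (abs_lt.2 h.2)

/-- The dilation `s⁻¹ w(s ·)` of a map. -/
noncomputable def dilate (s : ℝ) (w : Pt2 → V3) (y : Pt2) : V3 := s⁻¹ • w (s • y)

theorem qd_comp_smul {q : Pt2 → V3} (hq : Differentiable ℝ q) (c s : ℝ) (e y : Pt2) :
    qd e (fun y => c • q (s • y)) y = (c * s) • qd e q (s • y) := by
  have h1 : HasFDerivAt (fun y : Pt2 => s • y) (s • ContinuousLinearMap.id ℝ Pt2) y :=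
    (hasFDerivAt_id y).const_smul s
  have h2 := ((hq (s • y)).hasFDerivAt.comp y h1).const_smul c
  have h3 : HasFDerivAt (fun y => c • q (s • y)) _ y := h2
  unfold qd
  rw [h3.fderiv]
  simp [mul_smul]

theorem qd_dilate {s : ℝ} (hs : 0 < s) {w : Pt2 → V3} (hw : ContDiff ℝ 2 w) (e : Pt2) :
    qd e (dilate s w) = fun y => (1 : ℝ) • qd e w (s • y) := by
  funext y
  have := qd_comp_smul (hw.differentiable (by norm_num)) s⁻¹ s e y
  rwa [inv_mul_cancel₀ hs.ne'] at this

theorem IsProfile.dilate {a A3 : V3} {L Γ s : ℝ} (hs : 0 < s) {w : Pt2 → V3}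
    (hw : IsProfile a A3 L Γ w) : IsProfile a A3 (L / s) (Γ / s) (dilate s w) := by
  have key : ∀ y : Pt2, |y.2| < Γ / s / 2 → |(s • y).2| < Γ / 2 := by
    intro y hy
    rw [div_right_comm, lt_div_iff₀ hs] at hy
    simpa [abs_mul, abs_of_pos hs, mul_comm] using hy
  have kr : ∀ y : Pt2, L / s < y.1 → L < (s • y).1 := by
    intro y hy
    rw [div_lt_iff₀ hs] at hy
    simpa [mul_comm] using hy
  have kl : ∀ y : Pt2, y.1 < -(L / s) → (s • y).1 < -L := by
    intro y hy
    rw [← neg_div, lt_div_iff₀ hs] at hy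
    simpa [mul_comm] using hy
  refine ⟨?_, div_pos hw.pos hs, ?_, ?_⟩
  · exact (hw.contDiff.comp (contDiff_id.const_smul s)).const_smul s⁻¹
  · rw [qd_dilate hs hw.contDiff]
    intro y hy
    simp only [one_smul]
    exact ⟨fun h => (hw.tail1 _ (key y hy)).1 (kr y h), fun h => (hw.tail1 _ (key y hy)).2 (kl y h)⟩
  · rw [qd_dilate hs hw.contDiff]
    intro y hy
    simp only [one_smul]
    exact ⟨fun h => (hw.tail2 _ (key y hy)).1 (kr y h), fun h => (hw.tail2 _ (key y hy)).2 (kl y h)⟩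

theorem dens_dilate_le {W : M33 → ℝ} {s : ℝ} (hs : 0 < s) (hs1 : s ≤ 1) {w : Pt2 → V3}
    (hw : ContDiff ℝ 2 w) (y : Pt2) : dens W (dilate s w) y ≤ dens W w (s • y) := by
  have hd : ∀ e, Differentiable ℝ (qd e w) := fun e =>
    (contDiff_qd_one hw e).differentiable (by norm_num)
  unfold dens
  refine add_le_add (le_of_eq ?_) ?_
  · unfold W2; rw [qd_dilate hs hw, qd_dilate hs hw]; simp
  · unfold hess2d
    simp only [qd_dilate hs hw, qd_comp_smul (hd _), vnorm_smul_sq]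
    have h2 : (1 * s) ^ 2 ≤ 1 := by rw [one_mul]; exact pow_le_one₀ hs.le hs1
    have : ∀ z : V3, (1 * s) ^ 2 * vnorm z ^ 2 ≤ vnorm z ^ 2 := fun z =>
      mul_le_of_le_one_left (by positivity) h2
    gcongr <;> apply this

theorem energy_dilate_le {W : M33 → ℝ} (hWc : Continuous W) {γ s : ℝ} (hs : 0 < s) (hs1 : s ≤ 1)
    {w : Pt2 → V3} (hw : ContDiff ℝ 2 w) :
    energy W γ (dilate s w) ≤ ENNReal.ofReal (s ^ 2)⁻¹ * (ENNReal.ofReal γ⁻¹ *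
      ∫⁻ y in (univ : Set ℝ) ×ˢ Ioo (-(s * γ / 2)) (s * γ / 2), ENNReal.ofReal (dens W w y)) := by
  unfold energy
  rw [mul_left_comm]
  gcongr
  set S : Set Pt2 := (univ : Set ℝ) ×ˢ Ioo (-(s * γ / 2)) (s * γ / 2) with hS
  have hSm : MeasurableSet S := MeasurableSet.univ.prod measurableSet_Ioo
  have hg : Measurable (fun y => ENNReal.ofReal (dens W w y)) :=
    (continuous_dens hWc hw).measurable.ennreal_ofReal
  have hmap := Measure.map_addHaar_smul (volume : Measure Pt2) hs.ne'
  have hfin : Module.finrank ℝ Pt2 = 2 := by simp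
  rw [hfin, abs_of_pos (by positivity)] at hmap
  calc ∫⁻ y in (univ : Set ℝ) ×ˢ Ioo (-(γ / 2)) (γ / 2), ENNReal.ofReal (dens W (dilate s w) y)
      ≤ ∫⁻ y, S.indicator (fun y => ENNReal.ofReal (dens W w y)) (s • y) := by
        rw [← lintegral_indicator (MeasurableSet.univ.prod measurableSet_Ioo)]
        refine lintegral_mono fun y => ?_
        by_cases hy : y ∈ (univ : Set ℝ) ×ˢ Ioo (-(γ / 2)) (γ / 2)
        swap
        · rw [indicator_of_notMem hy]; exact zero_le
        rw [indicator_of_mem hy, indicator_of_mem]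
        · exact ENNReal.ofReal_le_ofReal (dens_dilate_le hs hs1 hw y)
        · have h1 := hy.2.1
          have h2 := hy.2.2
          refine ⟨trivial, ?_, ?_⟩ <;> simp only [Prod.smul_snd, smul_eq_mul] <;> nlinarith
    _ = ∫⁻ y, S.indicator (fun y => ENNReal.ofReal (dens W w y)) y
          ∂(Measure.map (fun y => s • y) volume) := by
        rw [lintegral_map (hg.indicator hSm) (measurable_const_smul s)]
    _ = _ := by
        rw [hmap, lintegral_smul_measure, lintegral_indicator hSm, smul_eq_mul]

/-! ### Near-optimal profiles -/

theorem exists_isProfile (a A3 : V3) (Γ : ℝ) : ∃ w, IsProfile a A3 (1 / 2) Γ w := by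
  set ψ : ℝ → ℝ := fun t => 2 * Real.smoothTransition (t + 1 / 2) - 1 with hψ
  set ℓ : Pt2 →L[ℝ] V3 := (ContinuousLinearMap.fst ℝ ℝ ℝ).smulRight a +
    (ContinuousLinearMap.snd ℝ ℝ ℝ).smulRight A3 with hℓ
  have hψC : ContDiff ℝ 2 ψ :=
    (contDiff_const.mul ((Real.smoothTransition.contDiff (n := 2)).comp
      (contDiff_id.add contDiff_const))).sub contDiff_const
  set w : Pt2 → V3 := fun y => ψ y.1 • ℓ y with hw
  have hR : ∀ y : Pt2, 1 / 2 < y.1 → ∀ e, qd e w y = ℓ e := by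
    intro y hy e
    have : w =ᶠ[𝓝 y] ℓ := by
      filter_upwards [(isOpen_lt continuous_const continuous_fst).mem_nhds hy] with z hz
      have hz' : 1 / 2 < z.1 := hz
      simp only [hw, hψ]
      rw [Real.smoothTransition.one_of_one_le (by linarith)]
      norm_num
    unfold qd
    rw [this.fderiv_eq, ContinuousLinearMap.fderiv]
  have hL : ∀ y : Pt2, y.1 < -(1 / 2) → ∀ e, qd e w y = -ℓ e := by
    intro y hy e
    have : w =ᶠ[𝓝 y] (-ℓ : Pt2 →L[ℝ] V3) := by
      filter_upwards [(isOpen_lt continuous_fst continuous_const).mem_nhds hy] with z hz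
      have hz' : z.1 < -(1 / 2) := hz
      simp only [hw, hψ]
      rw [Real.smoothTransition.zero_of_nonpos (by linarith)]
      norm_num
    unfold qd
    rw [this.fderiv_eq, ContinuousLinearMap.fderiv]; rfl
  have h1 : ℓ f1 = a := by simp [hℓ, f1]
  have h2 : ℓ f2 = A3 := by simp [hℓ, f2]
  refine ⟨w, (hψC.comp contDiff_fst).smul ℓ.contDiff, by norm_num,
    fun y _ => ⟨fun h => ?_, fun h => ?_⟩, fun y _ => ⟨fun h => ?_, fun h => ?_⟩⟩
  · rw [hR y h, h1]
  · rw [hL y h, h1]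
  · rw [hR y h, h2]
  · rw [hL y h, h2]

/-- A continuous function on the plane is bounded on a compact part of the strip. -/
theorem exists_bound_core {E : Type*} [NormedAddCommGroup E] {q : Pt2 → E} (hq : Continuous q)
    (L Γ : ℝ) : ∃ M, 0 ≤ M ∧ ∀ y : Pt2, |y.1| ≤ L → |y.2| ≤ Γ → ‖q y‖ ≤ M := by
  have hc : IsCompact ((Icc (-L) L) ×ˢ (Icc (-Γ) Γ) : Set Pt2) := isCompact_Icc.prod isCompact_Icc
  obtain ⟨M, hM⟩ := hc.exists_bound_of_continuousOn hq.continuousOn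
  exact ⟨max M 0, le_max_right _ _, fun y h1 h2 =>
    (hM y ⟨abs_le.1 h1, abs_le.1 h2⟩).trans (le_max_left _ _)⟩

theorem Kgam_lt_top {W : M33 → ℝ} (hWc : Continuous W) (a A3 : V3) {γ : ℝ} :
    Kgam W a A3 γ < ⊤ := by
  obtain ⟨w, hw⟩ := exists_isProfile a A3 γ
  obtain ⟨M, hM0, hM⟩ := exists_bound_core (continuous_dens hWc hw.contDiff) 1 (γ / 2)
  refine lt_of_le_of_lt (sInf_le ⟨2, by norm_num, w, hw.contDiff.contDiffOn,
    ⟨1 / 2, by norm_num, ?_⟩, ⟨1 / 2, by norm_num, ?_⟩, rfl⟩) ?_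
  · intro y hy h
    have hy2 : |y.2| < γ / 2 := abs_lt.2 hy.2
    exact ⟨(hw.tail1 y hy2).1 (by linarith), (hw.tail2 y hy2).1 (by linarith)⟩
  · intro y hy h
    have hy2 : |y.2| < γ / 2 := abs_lt.2 hy.2
    exact ⟨(hw.tail1 y hy2).2 (by linarith), (hw.tail2 y hy2).2 (by linarith)⟩
  · refine ENNReal.mul_lt_top ENNReal.ofReal_lt_top ?_
    refine lt_of_le_of_lt (setLIntegral_mono (g := fun _ => ENNReal.ofReal M)
      measurable_const ?_) ?_
    · intro y hy
      refine ENNReal.ofReal_le_ofReal ((le_abs_self _).trans (hM y ?_ (abs_lt.2 hy.2).le))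
      exact (abs_lt.2 (by simpa using hy.1)).le
    · rw [setLIntegral_const]
      refine ENNReal.mul_lt_top ENNReal.ofReal_lt_top ?_
      rw [Rect, Measure.volume_eq_prod, Measure.prod_prod, Real.volume_Ioo, Real.volume_Ioo]
      exact ENNReal.mul_lt_top ENNReal.ofReal_lt_top ENNReal.ofReal_lt_top

theorem exists_profile_energy_lt {W : M33 → ℝ} (hWc : Continuous W) {a A3 : V3}
    (hp : W ![a, 0, A3] = 0) (hm : W ![-a, 0, -A3] = 0) {γ : ℝ} (hγ : 0 < γ) {c : ℝ≥0∞}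
    (hc : Kgam W a A3 γ < c) :
    ∃ w L Γ, γ < Γ ∧ IsProfile a A3 L Γ w ∧ energy W γ w < c := by
  obtain ⟨e, ⟨ℓ, hℓ, v, hv, hr, hl, he⟩, hec⟩ := sInf_lt_iff.1 hc
  have hlim : Tendsto (fun s : ℝ => ENNReal.ofReal (s ^ 2)⁻¹ * e) (𝓝[<] 1) (𝓝 e) := by
    have h1 : Tendsto (fun s : ℝ => ENNReal.ofReal (s ^ 2)⁻¹) (𝓝 1) (𝓝 1) := by
      have h0 : ContinuousAt (fun s : ℝ => (s ^ 2)⁻¹) 1 :=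
        ContinuousAt.inv₀ (by fun_prop) (by norm_num)
      have := (ENNReal.continuous_ofReal.tendsto _).comp h0.tendsto
      simpa [Function.comp_def] using this
    have := ENNReal.Tendsto.mul_const (b := e) (h1.mono_left (nhdsWithin_le_nhds (s := Iio 1)))
      (Or.inl one_ne_zero)
    simpa using this
  obtain ⟨s, hs, hs0, hs1⟩ := ((hlim.eventually (gt_mem_nhds hec)).and
    (Ioo_mem_nhdsLT (zero_lt_one (α := ℝ)))).exists
  have hsγ : s * γ < γ := mul_lt_of_lt_one_left hγ hs1
  obtain ⟨Γ, hΓ1, hΓ2⟩ := exists_between hsγ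
  have hΓ0 : 0 < Γ := lt_trans (mul_pos hs0 hγ) hΓ1
  obtain ⟨w, L, hw, hwe⟩ := exists_profile_extension hp hm hℓ hv hr hl hΓ0 hΓ2
  refine ⟨dilate s w, L / s, Γ / s, ?_, hw.dilate hs0, ?_⟩
  · rw [lt_div_iff₀ hs0]; linarith
  · refine lt_of_le_of_lt (energy_dilate_le hWc hs0 hs1.le hw.contDiff) (lt_of_le_of_lt ?_ hs)
    rw [he]
    refine mul_le_mul_right (mul_le_mul_right (le_trans ?_ hwe) _) _
    refine lintegral_mono_set (prod_mono subset_rfl (Ioo_subset_Ioo ?_ ?_)) <;> linarith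

theorem exists_profile_seq {W : M33 → ℝ} (hWc : Continuous W) {a A3 : V3}
    (hp : W ![a, 0, A3] = 0) (hm : W ![-a, 0, -A3] = 0) {γ : ℝ} (hγ : 0 < γ) :
    ∃ (w : ℕ → Pt2 → V3) (L Γ : ℕ → ℝ), (∀ k, γ < Γ k ∧ IsProfile a A3 (L k) (Γ k) (w k)) ∧
      Tendsto (fun k => energy W γ (w k)) atTop (𝓝 (Kgam W a A3 γ)) := by
  have hK := Kgam_lt_top hWc a A3 (γ := γ)
  have h : ∀ k : ℕ, ∃ w L Γ, γ < Γ ∧ IsProfile a A3 L Γ w ∧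
      energy W γ w < Kgam W a A3 γ + ((k : ℝ≥0∞) + 1)⁻¹ := fun k =>
    exists_profile_energy_lt hWc hp hm hγ (ENNReal.lt_add_right hK.ne (by simp))
  choose w L Γ h1 h2 h3 using h
  refine ⟨w, L, Γ, fun k => ⟨h1 k, h2 k⟩, ?_⟩
  refine tendsto_of_tendsto_of_tendsto_of_le_of_le tendsto_const_nhds ?_
    (fun k => Kgam_le_energy (h2 k) (h1 k).le) (fun k => (h3 k).le)
  have h4 : Tendsto (fun k : ℕ => ((k : ℝ≥0∞) + 1)⁻¹) atTop (𝓝 0) := by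
    have := (tendsto_add_atTop_iff_nat 1).2 ENNReal.tendsto_inv_nat_nhds_zero
    simpa using this
  simpa using tendsto_const_nhds.add h4

/-! ### Signs of the laminate -/

/-- The sign `1` to the right of `α`, `-1` elsewhere. -/
noncomputable def side (α t : ℝ) : ℝ := if α < t then 1 else -1

/-- The sign of the laminate to the right of its `i`-th interface. -/
noncomputable def jumpSign {m : ℕ} (σ : ℝ) (i : Fin m) : ℝ := σ * (-1) ^ ((i : ℕ) + 1)

/-- The affine correction making the superposition of the interfaces equal to the laminate. -/
noncomputable def offset (m : ℕ) (σ : ℝ) : ℝ := σ + ∑ i : Fin m, jumpSign σ i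

theorem jumpSign_eq {m : ℕ} {σ : ℝ} (hσ : σ = 1 ∨ σ = -1) (i : Fin m) :
    jumpSign σ i = 1 ∨ jumpSign σ i = -1 := by
  unfold jumpSign
  rcases hσ with rfl | rfl <;> rcases neg_one_pow_eq_or ℝ ((i : ℕ) + 1) with h | h <;> simp [h]

theorem sum_jumpSign_side (m : ℕ) {α : Fin m → ℝ} (hα : StrictMono α) (σ t : ℝ) :
    ∑ i, jumpSign σ i * side (α i) t + offset m σ = σ * (-1) ^ cnt m α t := by
  unfold offset
  induction m with
  | zero => simp [cnt]
  | succ m ih =>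
    have ih := ih (α := fun i => α i.castSucc) (hα.comp Fin.strictMono_castSucc)
    rw [Fin.sum_univ_castSucc, Fin.sum_univ_castSucc]
    have hc : cnt (m + 1) α t =
        cnt m (fun i => α i.castSucc) t + if α (Fin.last m) < t then 1 else 0 := by
      unfold cnt
      simp only [Finset.card_filter]
      rw [Fin.sum_univ_castSucc]
    have hj : ∀ i : Fin m, jumpSign σ i.castSucc = jumpSign σ i := fun i => by simp [jumpSign]
    simp only [hj]
    rw [hc]
    by_cases h : α (Fin.last m) < t
    · have hm : cnt m (fun i => α i.castSucc) t = m := by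
        unfold cnt
        rw [Finset.filter_true_of_mem]
        · simp
        · intro i _
          exact (hα (Fin.castSucc_lt_last i)).trans h
      rw [hm] at ih
      simp only [h, if_true, hm, side, jumpSign, Fin.val_last] at ih ⊢
      rw [pow_succ]
      linarith
    · simp only [h, if_false, side, add_zero] at ih ⊢
      linarith

theorem cnt_apply_self {m : ℕ} {α : Fin m → ℝ} (hα : StrictMono α) (i : Fin m) :
    cnt m α (α i) = i := by
  unfold cnt
  have : Finset.univ.filter (fun j => α j < α i) = Finset.Iio i := by
    ext j; simp [hα.lt_iff_lt]
  rw [this, Fin.card_Iio]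

theorem sum_erase_jumpSign_side {m : ℕ} {α : Fin m → ℝ} (hα : StrictMono α) (σ : ℝ) (i : Fin m) :
    ∑ j ∈ Finset.univ.erase i, jumpSign σ j * side (α j) (α i) + offset m σ = 0 := by
  have h := sum_jumpSign_side m hα σ (α i)
  rw [← Finset.add_sum_erase _ _ (Finset.mem_univ i), cnt_apply_self hα] at h
  have h1 : jumpSign σ i * side (α i) (α i) = σ * (-1) ^ (i : ℕ) := by
    simp [jumpSign, side, pow_succ]
  linarith

/-! ### Superposition of rescaled profiles -/

/-- Rescaled coordinates at the interface `{x₁ = α}`. -/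
noncomputable def blow (α s ε h : ℝ) (x : Pt) : Pt2 := (s / ε * (x.1 - α), s * h / ε * x.2.2)

/-- The superposition of rescaled profiles at the interfaces, plus an affine map. -/
noncomputable def recov {m : ℕ} (α : Fin m → ℝ) (σ : ℝ) (a A3 d : V3) (w : Pt2 → V3) (h ε : ℝ)
    (x : Pt) : V3 :=
  ∑ i, (jumpSign σ i * ε) • w (blow (α i) (jumpSign σ i) ε h x) +
    ((offset m σ * x.1) • a + (offset m σ * h * x.2.2) • A3 + d)

theorem hasFDerivAt_blow (α s ε h : ℝ) (x : Pt) : HasFDerivAt (blow α s ε h)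
    (((s / ε) • ContinuousLinearMap.fst ℝ ℝ (ℝ × ℝ)).prod ((s * h / ε) •
      ((ContinuousLinearMap.snd ℝ ℝ ℝ).comp (ContinuousLinearMap.snd ℝ ℝ (ℝ × ℝ))))) x := by
  have h1 : HasFDerivAt (fun x : Pt => x.1) (ContinuousLinearMap.fst ℝ ℝ (ℝ × ℝ)) x :=
    hasFDerivAt_fst
  have h2 : HasFDerivAt (fun x : Pt => x.2.2) ((ContinuousLinearMap.snd ℝ ℝ ℝ).comp
      (ContinuousLinearMap.snd ℝ ℝ (ℝ × ℝ))) x :=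
    ((ContinuousLinearMap.snd ℝ ℝ ℝ).comp (ContinuousLinearMap.snd ℝ ℝ (ℝ × ℝ))).hasFDerivAt
  exact ((h1.sub_const α).const_mul (s / ε)).prodMk (h2.const_mul (s * h / ε))

theorem contDiff_blow (α s ε h : ℝ) : ContDiff ℝ 2 (blow α s ε h) := by
  unfold blow; fun_prop

theorem hasFDerivAt_blow_sum {m : ℕ} (α s c : Fin m → ℝ) (ε h : ℝ) {q : Pt2 → V3}
    (hq : Differentiable ℝ q) {r : Pt → V3} {r' : Pt →L[ℝ] V3} {x : Pt} (hr : HasFDerivAt r r' x) :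
    (∀ e, pd e (fun x => ∑ i, c i • q (blow (α i) (s i) ε h x) + r x) x =
      ∑ i, c i • fderiv ℝ q (blow (α i) (s i) ε h x) (s i / ε * e.1, s i * h / ε * e.2.2)
        + r' e) := by
  intro e
  have h1 : ∀ i ∈ Finset.univ, HasFDerivAt (fun x => c i • q (blow (α i) (s i) ε h x)) _ x :=
    fun i _ => ((hq _).hasFDerivAt.comp x (hasFDerivAt_blow (α i) (s i) ε h x)).const_smul (c i)
  have h2 := (HasFDerivAt.fun_sum h1).add hr
  have h3 : HasFDerivAt (fun x => ∑ i, c i • q (blow (α i) (s i) ε h x) + r x) _ x := h2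
  unfold pd
  rw [h3.fderiv]
  simp

theorem pd_e1_blow_sum {m : ℕ} (α s c : Fin m → ℝ) (ε h : ℝ) {q : Pt2 → V3}
    (hq : Differentiable ℝ q) {r : Pt → V3} {r' : Pt →L[ℝ] V3} {x : Pt} (hr : HasFDerivAt r r' x) :
    pd e1 (fun x => ∑ i, c i • q (blow (α i) (s i) ε h x) + r x) x =
      ∑ i, (c i * (s i / ε)) • qd f1 q (blow (α i) (s i) ε h x) + r' e1 := by
  rw [hasFDerivAt_blow_sum α s c ε h hq hr]
  congr 1
  refine Finset.sum_congr rfl fun i _ => ?_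
  rw [mul_smul, qd, ← (fderiv ℝ q _).map_smul (s i / ε)]
  simp [e1, f1]

theorem pd_e2_blow_sum {m : ℕ} (α s c : Fin m → ℝ) (ε h : ℝ) {q : Pt2 → V3}
    (hq : Differentiable ℝ q) {r : Pt → V3} {r' : Pt →L[ℝ] V3} {x : Pt} (hr : HasFDerivAt r r' x) :
    pd e2 (fun x => ∑ i, c i • q (blow (α i) (s i) ε h x) + r x) x = r' e2 := by
  rw [hasFDerivAt_blow_sum α s c ε h hq hr]
  have : ∀ y, fderiv ℝ q y (0, 0) = 0 := fun y => (fderiv ℝ q y).map_zero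
  simp [e2, this]

theorem pd_e3_blow_sum {m : ℕ} (α s c : Fin m → ℝ) (ε h : ℝ) {q : Pt2 → V3}
    (hq : Differentiable ℝ q) {r : Pt → V3} {r' : Pt →L[ℝ] V3} {x : Pt} (hr : HasFDerivAt r r' x) :
    pd e3 (fun x => ∑ i, c i • q (blow (α i) (s i) ε h x) + r x) x =
      ∑ i, (c i * (s i * h / ε)) • qd f2 q (blow (α i) (s i) ε h x) + r' e3 := by
  rw [hasFDerivAt_blow_sum α s c ε h hq hr]
  congr 1
  refine Finset.sum_congr rfl fun i _ => ?_
  rw [mul_smul, qd, ← (fderiv ℝ q _).map_smul (s i * h / ε)]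
  simp [e3, f2]

theorem contDiff_recov {m : ℕ} (α : Fin m → ℝ) (σ : ℝ) (a A3 d : V3) {w : Pt2 → V3}
    (hw : ContDiff ℝ 2 w) (h ε : ℝ) :
    ContDiff ℝ 2 (recov α σ a A3 d w h ε) := by
  unfold recov
  refine ContDiff.add (ContDiff.sum fun i _ => (hw.comp (contDiff_blow _ _ _ _)).const_smul _) ?_
  fun_prop

theorem hasFDerivAt_affine (a A3 d : V3) (h κ : ℝ) (x : Pt) :
    HasFDerivAt (fun x : Pt => (κ * x.1) • a + (κ * h * x.2.2) • A3 + d)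
      ((κ • ContinuousLinearMap.fst ℝ ℝ (ℝ × ℝ)).smulRight a + ((κ * h) •
        ((ContinuousLinearMap.snd ℝ ℝ ℝ).comp
          (ContinuousLinearMap.snd ℝ ℝ (ℝ × ℝ)))).smulRight A3) x := by
  have := ((κ • ContinuousLinearMap.fst ℝ ℝ (ℝ × ℝ)).smulRight a + ((κ * h) •
        ((ContinuousLinearMap.snd ℝ ℝ ℝ).comp
          (ContinuousLinearMap.snd ℝ ℝ (ℝ × ℝ)))).smulRight A3).hasFDerivAt (x := x)
  exact this.add_const d

theorem jumpSign_mul_self {m : ℕ} {σ : ℝ} (hσ : σ = 1 ∨ σ = -1) (i : Fin m) :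
    jumpSign σ i * jumpSign σ i = 1 := by
  rcases jumpSign_eq hσ i with h | h <;> simp [h]

theorem pd_e1_recov {m : ℕ} (α : Fin m → ℝ) {σ : ℝ} (hσ : σ = 1 ∨ σ = -1) (a A3 d : V3)
    {w : Pt2 → V3} (hw : ContDiff ℝ 2 w) (h : ℝ) {ε : ℝ} (hε : 0 < ε) :
    pd e1 (recov α σ a A3 d w h ε) =
    fun x => ∑ i, (1 : ℝ) • qd f1 w (blow (α i) (jumpSign σ i) ε h x) + offset m σ • a := by
  funext x
  have := pd_e1_blow_sum α (jumpSign σ) (fun i => jumpSign σ i * ε) ε h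
    (hw.differentiable (by norm_num)) (hasFDerivAt_affine a A3 d h (offset m σ) x)
  unfold recov
  rw [this]
  congr 1
  · refine Finset.sum_congr rfl fun i _ => ?_
    congr 1
    field_simp
    rw [sq, jumpSign_mul_self hσ]
  · simp [e1]

theorem pd_e2_recov {m : ℕ} (α : Fin m → ℝ) (σ : ℝ) (a A3 d : V3) {w : Pt2 → V3}
    (hw : ContDiff ℝ 2 w) (h ε : ℝ) : pd e2 (recov α σ a A3 d w h ε) = fun _ => 0 := by
  funext x
  have := pd_e2_blow_sum α (jumpSign σ) (fun i => jumpSign σ i * ε) ε h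
    (hw.differentiable (by norm_num)) (hasFDerivAt_affine a A3 d h (offset m σ) x)
  unfold recov
  rw [this]
  simp [e2]

theorem pd_e3_recov {m : ℕ} (α : Fin m → ℝ) {σ : ℝ} (hσ : σ = 1 ∨ σ = -1) (a A3 d : V3)
    {w : Pt2 → V3} (hw : ContDiff ℝ 2 w) (h : ℝ) {ε : ℝ} (hε : 0 < ε) :
    pd e3 (recov α σ a A3 d w h ε) =
    fun x => ∑ i, h • qd f2 w (blow (α i) (jumpSign σ i) ε h x) + (offset m σ * h) • A3 := by
  funext x
  have := pd_e3_blow_sum α (jumpSign σ) (fun i => jumpSign σ i * ε) ε h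
    (hw.differentiable (by norm_num)) (hasFDerivAt_affine a A3 d h (offset m σ) x)
  unfold recov
  rw [this]
  congr 1
  · refine Finset.sum_congr rfl fun i _ => ?_
    congr 1
    field_simp
    rw [sq, jumpSign_mul_self hσ]
    simp
  · simp [e3]

theorem inv_smul_pd_e3_recov {m : ℕ} (α : Fin m → ℝ) {σ : ℝ} (hσ : σ = 1 ∨ σ = -1) (a A3 d : V3)
    {w : Pt2 → V3} (hw : ContDiff ℝ 2 w) {h : ℝ} (hh : 0 < h) {ε : ℝ} (hε : 0 < ε) (x : Pt) :
    h⁻¹ • pd e3 (recov α σ a A3 d w h ε) x =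
    ∑ i, qd f2 w (blow (α i) (jumpSign σ i) ε h x) + offset m σ • A3 := by
  rw [pd_e3_recov α hσ a A3 d hw h hε]
  simp only [smul_add, ← Finset.smul_sum]
  rw [smul_smul, smul_smul, inv_mul_cancel₀ hh.ne', one_smul, mul_comm, mul_assoc,
    mul_inv_cancel₀ hh.ne', mul_one]

theorem hessh_recov {m : ℕ} (α : Fin m → ℝ) {σ : ℝ} (hσ : σ = 1 ∨ σ = -1) (a A3 d : V3)
    {w : Pt2 → V3} (hw : ContDiff ℝ 2 w) (h : ℝ) {ε : ℝ} (hε : 0 < ε) (x : Pt) :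
    hessh h (recov α σ a A3 d w h ε) x =
    vnorm (∑ i, (jumpSign σ i / ε) • qd f1 (qd f1 w) (blow (α i) (jumpSign σ i) ε h x)) ^ 2
    + (h⁻¹) ^ 4 * vnorm (∑ i, (h * (jumpSign σ i * h / ε)) •
        qd f2 (qd f2 w) (blow (α i) (jumpSign σ i) ε h x)) ^ 2
    + 2 * (h⁻¹) ^ 2 * vnorm (∑ i, (jumpSign σ i * h / ε) •
        qd f2 (qd f1 w) (blow (α i) (jumpSign σ i) ε h x)) ^ 2 := by
  have hd : ∀ e, Differentiable ℝ (qd e w) := fun e =>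
    (contDiff_qd_one hw e).differentiable (by norm_num)
  unfold hessh
  rw [pd_e1_recov α hσ a A3 d hw h hε, pd_e2_recov α σ a A3 d hw h ε,
    pd_e3_recov α hσ a A3 d hw h hε,
    pd_e1_blow_sum α (jumpSign σ) (fun _ => 1) ε h (hd f1) (hasFDerivAt_const _ _),
    pd_e2_blow_sum α (jumpSign σ) (fun _ => 1) ε h (hd f1) (hasFDerivAt_const _ _),
    pd_e3_blow_sum α (jumpSign σ) (fun _ => 1) ε h (hd f1) (hasFDerivAt_const _ _),
    pd_e3_blow_sum α (jumpSign σ) (fun _ => h) ε h (hd f2) (hasFDerivAt_const _ _)]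
  simp [pd]

/-! ### The superposition near and away from the interfaces -/

theorem blow_snd_abs_lt {s : ℝ} (hs : s = 1 ∨ s = -1) {h ε Γ : ℝ} (hh : 0 < h) (hε : 0 < ε)
    (hΓ : h / ε < Γ) {x : Pt} (hx : x.2.2 ∈ II) (α : ℝ) : |(blow α s ε h x).2| < Γ / 2 := by
  have hx' : |x.2.2| < 1 / 2 := abs_lt.2 ⟨by simpa using hx.1, hx.2⟩
  have h0 : 0 < h / ε := div_pos hh hε
  have h1 : |(blow α s ε h x).2| = h / ε * |x.2.2| := by
    unfold blow
    rw [abs_mul, mul_div_assoc, abs_mul, abs_of_pos h0]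
    rcases hs with rfl | rfl <;> simp
  rw [h1]
  nlinarith [abs_nonneg x.2.2]

theorem blow_fst_abs {s : ℝ} (hs : s = 1 ∨ s = -1) (h : ℝ) {ε : ℝ} (hε : 0 < ε) (x : Pt) (α : ℝ) :
    |(blow α s ε h x).1| = |x.1 - α| / ε := by
  unfold blow
  rw [abs_mul, abs_div, abs_of_pos hε]
  rcases hs with rfl | rfl <;> simp [div_eq_inv_mul]

theorem lt_blow_fst_abs {s : ℝ} (hs : s = 1 ∨ s = -1) (h : ℝ) {ε : ℝ} (hε : 0 < ε) {x : Pt}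
    {α L : ℝ} (hL : ε * L < |x.1 - α|) : L < |(blow α s ε h x).1| := by
  rw [blow_fst_abs hs h hε, lt_div_iff₀ hε]; linarith

theorem TailOn.blow {q : Pt2 → V3} {c : V3} {L Γ : ℝ} (hq : TailOn q c L Γ) (hL0 : 0 < L) {s : ℝ}
    (hs : s = 1 ∨ s = -1) {h ε : ℝ} (hh : 0 < h) (hε : 0 < ε) (hΓ : h / ε < Γ) {x : Pt}
    (hx : x.2.2 ∈ II) {α : ℝ} (hL : ε * L < |x.1 - α|) :
    q (blow α s ε h x) = (s * side α x.1) • c := by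
  have h2 := blow_snd_abs_lt hs hh hε hΓ hx α
  have hpos : 0 < ε * L := mul_pos hε hL0
  have hy : (_root_.blow α s ε h x).1 = s * ((x.1 - α) / ε) := by
    unfold _root_.blow; ring
  rcases lt_abs.1 hL with h' | h'
  · have h3 : side α x.1 = 1 := if_pos (by linarith)
    have h4 : L < (x.1 - α) / ε := by rw [lt_div_iff₀ hε]; linarith
    rw [h3]
    rcases hs with rfl | rfl
    · rw [(hq _ h2).1 (by rw [hy]; linarith)]; simp
    · rw [(hq _ h2).2 (by rw [hy]; linarith)]; simp
  · have h3 : side α x.1 = -1 := if_neg (by linarith)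
    have h4 : (x.1 - α) / ε < -L := by rw [div_lt_iff₀ hε]; linarith
    rw [h3]
    rcases hs with rfl | rfl
    · rw [(hq _ h2).2 (by rw [hy]; linarith)]; simp
    · rw [(hq _ h2).1 (by rw [hy]; linarith)]; simp

theorem sum_blow_far {m : ℕ} {α : Fin m → ℝ} (hα : StrictMono α) {σ : ℝ} (hσ : σ = 1 ∨ σ = -1)
    {q : Pt2 → V3} {c : V3} {L Γ : ℝ} (hq : TailOn q c L Γ) (hL0 : 0 < L) {h ε : ℝ} (hh : 0 < h)
    (hε : 0 < ε) (hΓ : h / ε < Γ) {x : Pt} (hx : x.2.2 ∈ II) (hL : ∀ i, ε * L < |x.1 - α i|) :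
    ∑ i, q (blow (α i) (jumpSign σ i) ε h x) + offset m σ • c =
      (σ * (-1) ^ cnt m α x.1) • c := by
  rw [← sum_jumpSign_side m hα, add_smul, Finset.sum_smul]
  congr 1
  exact Finset.sum_congr rfl fun i _ => hq.blow hL0 (jumpSign_eq hσ i) hh hε hΓ hx (hL i)

theorem far_of_near {α α' t r : ℝ} (h : |t - α| ≤ r) (h' : 2 * r < |α - α'|) : r < |t - α'| := by
  have := abs_sub_abs_le_abs_sub (α - α') (α - t)
  rw [abs_sub_comm α t, show α - α' - (α - t) = t - α' by ring] at this
  linarith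

theorem side_eq_of_near {α α' t r : ℝ} (h : |t - α| ≤ r) (h' : 2 * r < |α - α'|) :
    side α' t = side α' α := by
  have hr : 0 ≤ r := (abs_nonneg _).trans h
  rw [abs_le] at h
  unfold side
  rcases lt_abs.1 h' with h1 | h1
  · rw [if_pos (by linarith), if_pos (by linarith)]
  · rw [if_neg (by linarith), if_neg (by linarith)]

theorem sum_blow_near {m : ℕ} {α : Fin m → ℝ} (hα : StrictMono α) {σ : ℝ} (hσ : σ = 1 ∨ σ = -1)
    {q : Pt2 → V3} {c : V3} {L Γ : ℝ} (hq : TailOn q c L Γ) (hL0 : 0 < L) {h ε : ℝ} (hh : 0 < h)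
    (hε : 0 < ε) (hΓ : h / ε < Γ) {x : Pt} (hx : x.2.2 ∈ II)
    (hsep : ∀ i j, i ≠ j → 2 * (ε * L) < |α i - α j|) {i : Fin m} (hi : |x.1 - α i| ≤ ε * L) :
    ∑ j, q (blow (α j) (jumpSign σ j) ε h x) + offset m σ • c =
      q (blow (α i) (jumpSign σ i) ε h x) := by
  have h1 : ∑ j ∈ Finset.univ.erase i, q (blow (α j) (jumpSign σ j) ε h x) =
      (∑ j ∈ Finset.univ.erase i, jumpSign σ j * side (α j) (α i)) • c := by
    rw [Finset.sum_smul]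
    refine Finset.sum_congr rfl fun j hj => ?_
    have hij := hsep i j (Finset.ne_of_mem_erase hj).symm
    rw [hq.blow hL0 (jumpSign_eq hσ j) hh hε hΓ hx (far_of_near hi hij), side_eq_of_near hi hij]
  rw [← Finset.add_sum_erase _ _ (Finset.mem_univ i), h1, add_assoc, ← add_smul,
    sum_erase_jumpSign_side hα, zero_smul, add_zero]

theorem well_eq_zero {W : M33 → ℝ} {a A3 : V3} (hp : W ![a, 0, A3] = 0)
    (hm : W ![-a, 0, -A3] = 0) {σ : ℝ} (hσ : σ = 1 ∨ σ = -1) (n : ℕ) :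
    W ![(σ * (-1) ^ n) • a, 0, (σ * (-1) ^ n) • A3] = 0 := by
  rcases hσ with rfl | rfl <;> rcases neg_one_pow_eq_or ℝ n with h | h <;> rw [h] <;>
    simp [hp, hm]

/-- For small `ε` the rescaled energy density is the sum of the densities of the profiles. -/
theorem density_recov {W : M33 → ℝ} {a A3 : V3} (hp : W ![a, 0, A3] = 0)
    (hm : W ![-a, 0, -A3] = 0) {m : ℕ} {α : Fin m → ℝ} (hα : StrictMono α) {σ : ℝ}
    (hσ : σ = 1 ∨ σ = -1) {w : Pt2 → V3} {L Γ : ℝ} (hw : IsProfile a A3 L Γ w) (d : V3) {h ε : ℝ}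
    (hh : 0 < h) (hε : 0 < ε) (hΓ : h / ε < Γ) {x : Pt} (hx : x.2.2 ∈ II)
    (hsep : ∀ i j, i ≠ j → 2 * (ε * L) < |α i - α j|) :
    ε⁻¹ * W (gradh h (recov α σ a A3 d w h ε) x) + ε * hessh h (recov α σ a A3 d w h ε) x =
      ∑ i, ε⁻¹ * dens W w (blow (α i) (jumpSign σ i) ε h x) := by
  have hL0 := hw.pos
  have hstrip : ∀ i, |(blow (α i) (jumpSign σ i) ε h x).2| < Γ / 2 := fun i =>
    blow_snd_abs_lt (jumpSign_eq hσ i) hh hε hΓ hx (α i)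
  have hfar : ∀ i, ε * L < |x.1 - α i| → L < |(blow (α i) (jumpSign σ i) ε h x).1| := fun i hi =>
    lt_blow_fst_abs (jumpSign_eq hσ i) h hε hi
  have hgrad : gradh h (recov α σ a A3 d w h ε) x =
      ![∑ i, qd f1 w (blow (α i) (jumpSign σ i) ε h x) + offset m σ • a, 0,
        ∑ i, qd f2 w (blow (α i) (jumpSign σ i) ε h x) + offset m σ • A3] := by
    unfold gradh
    rw [inv_smul_pd_e3_recov α hσ a A3 d hw.contDiff hh hε,
      pd_e1_recov α hσ a A3 d hw.contDiff h hε,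
      pd_e2_recov α σ a A3 d hw.contDiff h ε]
    simp
  rw [hgrad, hessh_recov α hσ a A3 d hw.contDiff h hε]
  by_cases hall : ∀ i, ε * L < |x.1 - α i|
  · rw [sum_blow_far hα hσ hw.tail1 hL0 hh hε hΓ hx hall,
      sum_blow_far hα hσ hw.tail2 hL0 hh hε hΓ hx hall, well_eq_zero hp hm hσ]
    simp only [hw.dens_eq_zero hp hm (hstrip _) (hfar _ (hall _)),
      hw.tail1.qd_eq_zero (hstrip _) (hfar _ (hall _)),
      hw.tail2.qd_eq_zero (hstrip _) (hfar _ (hall _))]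
    simp
  · push Not at hall
    obtain ⟨i, hi⟩ := hall
    have hfar' : ∀ j, j ≠ i → L < |(blow (α j) (jumpSign σ j) ε h x).1| := fun j hj =>
      hfar j (far_of_near hi (hsep i j hj.symm))
    have hz : ∀ (q : Pt2 → V3) (c : V3), TailOn q c L Γ → ∀ (k : Fin m → ℝ) (e : Pt2),
        ∑ j, k j • qd e q (blow (α j) (jumpSign σ j) ε h x) =
          k i • qd e q (blow (α i) (jumpSign σ i) ε h x) := by
      intro q c hq k e
      refine Finset.sum_eq_single i (fun j _ hj => ?_) (by simp)
      rw [hq.qd_eq_zero (hstrip j) (hfar' j hj), smul_zero]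
    rw [sum_blow_near hα hσ hw.tail1 hL0 hh hε hΓ hx hsep hi,
      sum_blow_near hα hσ hw.tail2 hL0 hh hε hΓ hx hsep hi,
      hz _ _ hw.tail1, hz _ _ hw.tail1, hz _ _ hw.tail2,
      Finset.sum_eq_single i (fun j _ hj => by
        rw [hw.dens_eq_zero hp hm (hstrip j) (hfar' j hj), mul_zero]) (by simp)]
    simp only [vnorm_smul_sq]
    unfold dens W2 hess2d
    have hs := jumpSign_mul_self hσ i
    have hs2 : jumpSign σ i ^ 2 = 1 := by rw [sq, hs]
    simp only [mul_pow, div_pow, hs2]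
    field_simp
    ring

/-! ### Integral representation of the laminate -/

theorem side_hasDerivAt {α t : ℝ} (ht : t ≠ α) :
    HasDerivAt (fun t => |t - α|) (side α t) t := by
  unfold side
  split_ifs with h
  · have h1 : (fun t => |t - α|) =ᶠ[𝓝 t] fun t => t - α := by
      filter_upwards [lt_mem_nhds h] with z hz using abs_of_pos (by linarith)
    exact ((hasDerivAt_id t).sub_const α).congr_of_eventuallyEq h1
  · have h0 : t < α := lt_of_le_of_ne (not_lt.1 h) ht
    have h1 : (fun t => |t - α|) =ᶠ[𝓝 t] fun t => -(t - α) := by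
      filter_upwards [gt_mem_nhds h0] with z hz using abs_of_neg (by linarith)
    exact ((hasDerivAt_id t).sub_const α).neg.congr_of_eventuallyEq h1

theorem laminate_eq {m : ℕ} {α : Fin m → ℝ} (hα : StrictMono α) (σ : ℝ) {a : V3} {ubar : ℝ → V3}
    (hc : Continuous ubar) (hd : ∀ t, t ∉ range α →
      HasDerivAt ubar ((σ * (-1 : ℝ) ^ (cnt m α t)) • a) t) :
    ∃ d : V3, ∀ t, ubar t =
      ∑ i, (jumpSign σ i * |t - α i|) • a + (offset m σ * t) • a + d := by
  set g : ℝ → V3 := fun t => ∑ i, (jumpSign σ i * |t - α i|) • a + (offset m σ * t) • a with hg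
  have hgc : Continuous g := by
    simp only [hg]; fun_prop
  have hgd : ∀ t, t ∉ range α → HasDerivAt g ((σ * (-1 : ℝ) ^ (cnt m α t)) • a) t := by
    intro t ht
    rw [← sum_jumpSign_side m hα, add_smul, Finset.sum_smul]
    refine HasDerivAt.add (HasDerivAt.fun_sum fun i _ => ?_) ?_
    · exact ((side_hasDerivAt fun h => ht ⟨i, h.symm⟩).const_mul _).smul_const a
    · simpa using ((hasDerivAt_id t).const_mul (offset m σ)).smul_const a
  refine ⟨ubar 0 - g 0, fun t => ?_⟩
  have h := integral_eq_of_hasDerivAt_off_countable (fun t => ubar t - g t) (fun _ => 0)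
    (a := 0) (b := t) (s := range α) (countable_range α) (hc.sub hgc).continuousOn
    (fun x hx => by
      have := (hd x hx.2).sub (hgd x hx.2)
      rw [sub_self] at this
      exact this) (by simp)
  simp only [intervalIntegral.integral_zero] at h
  have h2 : ubar t = g t + (ubar 0 - g 0) := by
    have := sub_eq_zero.1 h.symm
    rw [← this]; abel
  exact h2

/-! ### Uniform bounds on the strip -/

theorem TailOn.exists_bound {q : Pt2 → V3} {c : V3} {L Γ : ℝ} (hq : TailOn q c L Γ)
    (hqc : Continuous q) : ∃ M, 0 ≤ M ∧ ∀ y : Pt2, |y.2| < Γ / 2 → ‖q y‖ ≤ M := by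
  obtain ⟨M, hM0, hM⟩ := exists_bound_core hqc L (Γ / 2)
  refine ⟨max M ‖c‖, le_max_of_le_left hM0, fun y hy => ?_⟩
  by_cases h : |y.1| ≤ L
  · exact (hM y h hy.le).trans (le_max_left _ _)
  · rcases lt_abs.1 (not_le.1 h) with h | h
    · rw [(hq y hy).1 h]; exact le_max_right _ _
    · rw [(hq y hy).2 (by linarith), norm_neg]; exact le_max_right _ _

theorem fderiv_eq_of_qd {w : Pt2 → V3} {y : Pt2} {ℓ : Pt2 →L[ℝ] V3} (h1 : qd f1 w y = ℓ f1)
    (h2 : qd f2 w y = ℓ f2) : fderiv ℝ w y = ℓ := by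
  refine ContinuousLinearMap.ext fun z => ?_
  have hz : z = z.1 • f1 + z.2 • f2 := by ext <;> simp [f1, f2]
  rw [hz, map_add, map_add, map_smul, map_smul, map_smul, map_smul, ← h1, ← h2]
  rfl

theorem IsProfile.exists_bound_sub {a A3 : V3} {L Γ : ℝ} {w : Pt2 → V3}
    (hw : IsProfile a A3 L Γ w) :
    ∃ M, 0 ≤ M ∧ ∀ y : Pt2, |y.2| < Γ / 2 → ‖w y - |y.1| • a‖ ≤ M := by
  have hL0 := hw.pos
  set ℓ : Pt2 →L[ℝ] V3 := (ContinuousLinearMap.fst ℝ ℝ ℝ).smulRight a +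
    (ContinuousLinearMap.snd ℝ ℝ ℝ).smulRight A3 with hℓ
  have h1 : ℓ f1 = a := by simp [hℓ, f1]
  have h2 : ℓ f2 = A3 := by simp [hℓ, f2]
  have hdw : Differentiable ℝ w := hw.contDiff.differentiable (by norm_num)
  have hcv : Convex ℝ {t : ℝ | |t| < Γ / 2} := by
    have : {t : ℝ | |t| < Γ / 2} = Ioo (-(Γ / 2)) (Γ / 2) := by ext t; simp [abs_lt]
    rw [this]; exact convex_Ioo _ _
  have hR : ∃ c, EqOn w (fun y => ℓ y + c) {y : Pt2 | L < y.1 ∧ |y.2| < Γ / 2} := by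
    refine (isOpen_right L Γ).exists_eq_add_of_fderiv_eq (𝕜 := ℝ) ?_ hdw.differentiableOn
      ℓ.differentiable.differentiableOn fun y hy => ?_
    · exact ((convex_Ioi L).prod hcv).isPreconnected
    · rw [ContinuousLinearMap.fderiv]
      exact fderiv_eq_of_qd (by rw [h1, (hw.tail1 y hy.2).1 hy.1])
        (by rw [h2, (hw.tail2 y hy.2).1 hy.1])
  have hL : ∃ c, EqOn w (fun y => (-ℓ) y + c) {y : Pt2 | y.1 < -L ∧ |y.2| < Γ / 2} := by
    refine (isOpen_left L Γ).exists_eq_add_of_fderiv_eq (𝕜 := ℝ) ?_ hdw.differentiableOn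
      (-ℓ).differentiable.differentiableOn fun y hy => ?_
    · exact ((convex_Iio (-L)).prod hcv).isPreconnected
    · rw [ContinuousLinearMap.fderiv]
      refine fderiv_eq_of_qd ?_ ?_
      · rw [neg_apply, h1, (hw.tail1 y hy.2).2 hy.1]
      · rw [neg_apply, h2, (hw.tail2 y hy.2).2 hy.1]
  obtain ⟨c, hc⟩ := hR
  obtain ⟨c', hc'⟩ := hL
  obtain ⟨M, hM0, hM⟩ := exists_bound_core (q := fun y => w y - |y.1| • a)
    (hdw.continuous.sub (by fun_prop)) L (Γ / 2)
  refine ⟨M + (Γ / 2 * ‖A3‖ + ‖c‖ + ‖c'‖) ⊔ 0, by positivity, fun y hy => ?_⟩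
  have hA : ‖y.2 • A3‖ ≤ Γ / 2 * ‖A3‖ := by
    rw [norm_smul, Real.norm_eq_abs]; gcongr
  have hs := le_max_left (Γ / 2 * ‖A3‖ + ‖c‖ + ‖c'‖) 0
  have hn := norm_nonneg c
  have hn' := norm_nonneg c'
  by_cases h : |y.1| ≤ L
  · have := hM y h hy.le
    have := le_max_right (Γ / 2 * ‖A3‖ + ‖c‖ + ‖c'‖) 0
    linarith
  · rcases lt_abs.1 (not_le.1 h) with h | h
    · rw [hc ⟨h, hy⟩, abs_of_pos (by linarith)]
      have : ℓ y + c - y.1 • a = y.2 • A3 + c := by simp [hℓ]; abel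
      simp only [this]
      linarith [norm_add_le (y.2 • A3) c]
    · rw [hc' ⟨show y.1 < -L by linarith, hy⟩, abs_of_neg (by linarith)]
      have : (-ℓ) y + c' - (-y.1) • a = -(y.2 • A3) + c' := by simp [hℓ]; abel
      simp only [this]
      have := norm_add_le (-(y.2 • A3)) c'
      rw [norm_neg] at this
      linarith

/-! ### The domain -/

theorem isOpen_Om {ω : Set (ℝ × ℝ)} (hω : IsOpen ω) : IsOpen (Om ω) := by
  have h1 : Continuous fun x : Pt => (x.1, x.2.1) := by fun_prop
  have h2 : Continuous fun x : Pt => x.2.2 := by fun_prop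
  exact (hω.preimage h1).inter ((isOpen_Ioo (a := -(1 / 2 : ℝ)) (b := 1 / 2)).preimage h2)

theorem volume_Om_lt_top {ω : Set (ℝ × ℝ)} (hω : Bornology.IsBounded ω) : volume (Om ω) < ⊤ := by
  obtain ⟨R, hR⟩ := isBounded_iff_forall_norm_le.1 hω
  refine Bornology.IsBounded.measure_lt_top (isBounded_iff_forall_norm_le.2 ⟨max R 1, ?_⟩)
  rintro ⟨x1, x2, x3⟩ ⟨hx, hx3⟩
  have h := hR _ hx
  have h3 : ‖x3‖ ≤ 1 := by
    have := hx3.1; have := hx3.2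
    rw [Real.norm_eq_abs, abs_le]; constructor <;> linarith
  rw [Prod.norm_mk] at h ⊢
  rw [Prod.norm_mk]
  have h1 := (le_max_left _ _).trans h
  have h2 := (le_max_right _ _).trans h
  exact max_le (h1.trans (le_max_left _ _)) (max_le (h2.trans (le_max_left _ _))
    (h3.trans (le_max_right _ _)))

theorem ae_notMem_interfaces {m : ℕ} (α : Fin m → ℝ) : ∀ᵐ x : Pt, x.1 ∉ range α := by
  have h : ∀ᵐ t : ℝ, t ∉ range α := (countable_range α).ae_notMem volume
  exact Measure.quasiMeasurePreserving_fst.ae h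

/-- Bounded pointwise convergence to zero on a set of finite measure. -/
theorem tendsto_setLIntegral_zero {S : Set Pt} (hS : MeasurableSet S) (hfin : volume S < ⊤)
    {f : ℕ → Pt → ℝ} (hf : ∀ n, Measurable (f n)) (M : ℝ)
    (hM : ∀ᶠ n in atTop, ∀ x ∈ S, f n x ≤ M) {P : Pt → Prop} (hP : ∀ᵐ x : Pt, P x)
    (hlim : ∀ x ∈ S, P x → Tendsto (fun n => f n x) atTop (𝓝 0)) :
    Tendsto (fun n => ∫⁻ x in S, ENNReal.ofReal (f n x)) atTop (𝓝 0) := by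
  have := tendsto_lintegral_filter_of_dominated_convergence (μ := volume.restrict S)
    (F := fun n x => ENNReal.ofReal (f n x)) (f := fun _ => 0) (l := atTop)
    (fun _ => ENNReal.ofReal M) (Eventually.of_forall fun n => (hf n).ennreal_ofReal) ?_ ?_ ?_
  · simpa using this
  · filter_upwards [hM] with n hn
    filter_upwards [ae_restrict_mem hS] with x hx using ENNReal.ofReal_le_ofReal (hn x hx)
  · rw [setLIntegral_const]; exact (ENNReal.mul_lt_top ENNReal.ofReal_lt_top hfin).ne
  · filter_upwards [ae_restrict_mem hS, ae_restrict_of_ae hP] with x hx hx'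
    have := (ENNReal.continuous_ofReal.tendsto 0).comp (hlim x hx hx')
    simpa [Function.comp_def] using this

theorem measurable_laminateSign (m : ℕ) (α : Fin m → ℝ) (σ : ℝ) :
    Measurable fun t => σ * (-1 : ℝ) ^ cnt m α t := by
  have h : ∀ t, (-1 : ℝ) ^ cnt m α t = ∏ i, if α i < t then -1 else 1 := by
    intro t
    rw [cnt, ← Finset.prod_const, Finset.prod_filter]
  simp only [h]
  refine (Finset.measurable_fun_prod _ fun i _ => ?_).const_mul σ
  exact Measurable.ite measurableSet_Ioi measurable_const measurable_const

theorem vnorm_rpow_le {v : V3} {M p : ℝ} (hp : 0 ≤ p) (hv : ‖v‖ ≤ M) :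
    vnorm v ^ p ≤ (2 * M) ^ p :=
  Real.rpow_le_rpow (vnorm_nonneg v) ((vnorm_le v).trans (by linarith)) hp

theorem tendsto_vnorm_rpow {ι : Type*} {l : Filter ι} {v : ι → V3} {p : ℝ} (hp : 0 < p)
    (hv : Tendsto v l (𝓝 0)) : Tendsto (fun n => vnorm (v n) ^ p) l (𝓝 0) := by
  have h := (continuous_vnorm.tendsto 0).comp hv
  rw [vnorm_zero] at h
  have := h.rpow_const (Or.inr hp.le)
  rwa [Real.zero_rpow hp.ne'] at this

/-! ### Convergence of the recovery maps -/

theorem norm_laminateSign_smul {σ : ℝ} (hσ : σ = 1 ∨ σ = -1) (n : ℕ) (c : V3) :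
    ‖(σ * (-1) ^ n) • c‖ = ‖c‖ := by
  rcases hσ with rfl | rfl <;> rcases neg_one_pow_eq_or ℝ n with h | h <;> simp [h]

theorem norm_blow_sum_le {m : ℕ} {α : Fin m → ℝ} {σ : ℝ} (hσ : σ = 1 ∨ σ = -1)
    {q : Pt2 → V3} {c : V3} {M Γ : ℝ} (hM : ∀ y : Pt2, |y.2| < Γ / 2 → ‖q y‖ ≤ M) {h ε : ℝ}
    (hh : 0 < h) (hε : 0 < ε) (hΓ : h / ε < Γ) {x : Pt} (hx : x.2.2 ∈ II) (n : ℕ) :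
    ‖∑ i, q (blow (α i) (jumpSign σ i) ε h x) + offset m σ • c - (σ * (-1) ^ n) • c‖ ≤
      m * M + ‖offset m σ • c‖ + ‖c‖ := by
  refine (norm_sub_le _ _).trans (add_le_add ((norm_add_le _ _).trans
    (add_le_add ?_ le_rfl)) (norm_laminateSign_smul hσ n c).le)
  refine (norm_sum_le_of_le _ fun i _ =>
    hM _ (blow_snd_abs_lt (jumpSign_eq hσ i) hh hε hΓ hx (α i))).trans ?_
  simp

theorem norm_recov_sub_le {m : ℕ} {α : Fin m → ℝ} {σ : ℝ} (hσ : σ = 1 ∨ σ = -1) {a A3 d : V3}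
    {w : Pt2 → V3} {M Γ : ℝ} (hM : ∀ y : Pt2, |y.2| < Γ / 2 → ‖w y - |y.1| • a‖ ≤ M) {h ε : ℝ}
    (hh : 0 < h) (hε : 0 < ε) (hΓ : h / ε < Γ) {x : Pt} (hx : x.2.2 ∈ II) :
    ‖recov α σ a A3 d w h ε x -
      (∑ i, (jumpSign σ i * |x.1 - α i|) • a + (offset m σ * x.1) • a + d)‖ ≤
      ε * (m * M) + h * ‖offset m σ • A3‖ := by
  have hx' : |x.2.2| ≤ 1 := by
    have := hx.1; have := hx.2
    rw [abs_le]; constructor <;> linarith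
  have e1 : recov α σ a A3 d w h ε x -
      (∑ i, (jumpSign σ i * |x.1 - α i|) • a + (offset m σ * x.1) • a + d) =
      ∑ i, (jumpSign σ i * ε) • (w (blow (α i) (jumpSign σ i) ε h x) -
        |(blow (α i) (jumpSign σ i) ε h x).1| • a) + (h * x.2.2) • (offset m σ • A3) := by
    have : ∀ i, (jumpSign σ i * ε) • (w (blow (α i) (jumpSign σ i) ε h x) -
        |(blow (α i) (jumpSign σ i) ε h x).1| • a) =
        (jumpSign σ i * ε) • w (blow (α i) (jumpSign σ i) ε h x) -
          (jumpSign σ i * |x.1 - α i|) • a := by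
      intro i
      rw [blow_fst_abs (jumpSign_eq hσ i) h hε, smul_sub, smul_smul]
      congr 2
      field_simp
    simp only [this, Finset.sum_sub_distrib]
    unfold recov
    module
  rw [e1]
  refine (norm_add_le _ _).trans (add_le_add ?_ ?_)
  · refine (norm_sum_le_of_le (n := fun _ => ε * M) _ fun i _ => ?_).trans ?_
    · have hs : |jumpSign σ i| = 1 := by rcases jumpSign_eq hσ i with h | h <;> simp [h]
      rw [norm_smul, Real.norm_eq_abs, abs_mul, hs, one_mul, abs_of_pos hε]
      gcongr
      exact hM _ (blow_snd_abs_lt (jumpSign_eq hσ i) hh hε hΓ hx (α i))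
    · simp only [Finset.sum_const, Finset.card_univ, Fintype.card_fin, nsmul_eq_mul]
      exact le_of_eq (by ring)
  · rw [norm_smul, Real.norm_eq_abs, abs_mul, abs_of_pos hh]
    refine mul_le_mul_of_nonneg_right ?_ (norm_nonneg _)
    exact mul_le_of_le_one_right hh.le hx'

/-! ### Convergence in `L^p` -/

theorem eventually_far {m : ℕ} {α : Fin m → ℝ} {ε : ℕ → ℝ} (hε0 : Tendsto ε atTop (𝓝 0)) (L : ℝ)
    {t : ℝ} (ht : t ∉ range α) : ∀ᶠ n in atTop, ∀ i, ε n * L < |t - α i| := by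
  refine eventually_all.2 fun i => ?_
  have h0 : 0 < |t - α i| := abs_pos.2 (sub_ne_zero.2 fun h => ht ⟨i, h.symm⟩)
  have := hε0.mul_const L
  rw [zero_mul] at this
  exact this.eventually_lt_const h0

theorem eventually_separated {m : ℕ} {α : Fin m → ℝ} (hα : StrictMono α) {ε : ℕ → ℝ}
    (hε0 : Tendsto ε atTop (𝓝 0)) (L : ℝ) :
    ∀ᶠ n in atTop, ∀ i j, i ≠ j → 2 * (ε n * L) < |α i - α j| := by
  refine eventually_all.2 fun i => eventually_all.2 fun j => ?_
  by_cases hij : i = j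
  · exact Eventually.of_forall fun n h => absurd hij h
  · have h0 : 0 < |α i - α j| := abs_pos.2 (sub_ne_zero.2 (hα.injective.ne hij))
    have := (hε0.mul_const L).const_mul 2
    rw [zero_mul, mul_zero] at this
    filter_upwards [this.eventually_lt_const h0] with n hn _ using hn

theorem measurable_pd {u : Pt → V3} (hu : ContDiff ℝ 2 u) (e : Pt) : Measurable (pd e u) :=
  ((hu.continuous_fderiv (by norm_num)).clm_apply continuous_const).measurable

theorem measurable_laminateSign_smul (m : ℕ) (α : Fin m → ℝ) (σ : ℝ) (c : V3) :
    Measurable fun x : Pt => (σ * (-1 : ℝ) ^ cnt m α x.1) • c :=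
  ((measurable_laminateSign m α σ).comp measurable_fst).smul_const c

theorem measurable_vnorm_rpow {f : Pt → V3} (hf : Measurable f) (p : ℝ) :
    Measurable fun x => vnorm (f x) ^ p :=
  (continuous_vnorm.measurable.comp hf).pow_const p

section

variable {ω : Set (ℝ × ℝ)} {p γ σ : ℝ} {m : ℕ} {α : Fin m → ℝ} {a A3 d : V3} {w : Pt2 → V3}
  {L Γ : ℝ} {h ε : ℕ → ℝ}

theorem tendsto_recov_pd_e3 (hωo : IsOpen ω) (hωb : Bornology.IsBounded ω) (hp : 0 < p)
    (hα : StrictMono α) (hσ : σ = 1 ∨ σ = -1) (hw : IsProfile a A3 L Γ w) (hΓ : γ < Γ)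
    (hh : ∀ n, 0 < h n) (hε : ∀ n, 0 < ε n) (hε0 : Tendsto ε atTop (𝓝 0))
    (hratio : Tendsto (fun n => h n / ε n) atTop (𝓝 γ)) :
    Tendsto (fun n => ∫⁻ x in Om ω, ENNReal.ofReal
      (vnorm ((h n)⁻¹ • pd e3 (recov α σ a A3 d w (h n) (ε n)) x -
        (σ * (-1 : ℝ) ^ cnt m α x.1) • A3) ^ p)) atTop (𝓝 0) := by
  obtain ⟨M, -, hM⟩ := hw.tail2.exists_bound (contDiff_qd_one hw.contDiff f2).continuous
  have hr := hratio.eventually_lt_const hΓ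
  have hmeas : ∀ n, Measurable fun x => (h n)⁻¹ • pd e3 (recov α σ a A3 d w (h n) (ε n)) x -
      (σ * (-1 : ℝ) ^ cnt m α x.1) • A3 := fun n => by
    have h1 := measurable_pd (contDiff_recov α σ a A3 d hw.contDiff (h n) (ε n)) e3
    exact (h1.fun_const_smul (h n)⁻¹).fun_sub (measurable_laminateSign_smul m α σ A3)
  refine tendsto_setLIntegral_zero (isOpen_Om hωo).measurableSet (volume_Om_lt_top hωb)
    (fun n => measurable_vnorm_rpow (hmeas n) p) ((2 * (m * M + ‖offset m σ • A3‖ + ‖A3‖)) ^ p) ?_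
    (ae_notMem_interfaces α) ?_
  · filter_upwards [hr] with n hn x hx
    rw [inv_smul_pd_e3_recov α hσ a A3 d hw.contDiff (hh n) (hε n)]
    exact vnorm_rpow_le hp.le (norm_blow_sum_le hσ hM (hh n) (hε n) hn hx.2 _)
  · intro x hx hxα
    refine tendsto_const_nhds.congr' ?_
    filter_upwards [hr, eventually_far hε0 L hxα] with n hn hfar
    rw [inv_smul_pd_e3_recov α hσ a A3 d hw.contDiff (hh n) (hε n),
      sum_blow_far hα hσ hw.tail2 hw.pos (hh n) (hε n) hn hx.2 hfar, sub_self, vnorm_zero,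
      Real.zero_rpow hp.ne']

theorem tendsto_recov_pd_e1 (hωo : IsOpen ω) (hωb : Bornology.IsBounded ω) (hp : 0 < p)
    (hα : StrictMono α) (hσ : σ = 1 ∨ σ = -1) (hw : IsProfile a A3 L Γ w) (hΓ : γ < Γ)
    {ubar : ℝ → V3} (hubarc : Continuous ubar) (hubar : ∀ t, ubar t =
      ∑ i, (jumpSign σ i * |t - α i|) • a + (offset m σ * t) • a + d)
    (hh : ∀ n, 0 < h n) (hε : ∀ n, 0 < ε n) (hh0 : Tendsto h atTop (𝓝 0))
    (hε0 : Tendsto ε atTop (𝓝 0)) (hratio : Tendsto (fun n => h n / ε n) atTop (𝓝 γ)) :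
    Tendsto (fun n => ∫⁻ x in Om ω, ENNReal.ofReal
      (vnorm (recov α σ a A3 d w (h n) (ε n) x - ubar x.1) ^ p +
        vnorm (pd e1 (recov α σ a A3 d w (h n) (ε n)) x -
          (σ * (-1 : ℝ) ^ cnt m α x.1) • a) ^ p +
        vnorm (pd e2 (recov α σ a A3 d w (h n) (ε n)) x) ^ p)) atTop (𝓝 0) := by
  obtain ⟨M, hM0, hM⟩ := hw.tail1.exists_bound (contDiff_qd_one hw.contDiff f1).continuous
  obtain ⟨N, hN0, hN⟩ := hw.exists_bound_sub
  have hr := hratio.eventually_lt_const hΓ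
  have hcd := fun n => contDiff_recov α σ a A3 d hw.contDiff (h n) (ε n)
  have hlim : Tendsto (fun n => ε n * (m * N) + h n * ‖offset m σ • A3‖) atTop (𝓝 0) := by
    simpa using (hε0.mul_const (m * N)).add (hh0.mul_const ‖offset m σ • A3‖)
  have e2_zero : ∀ n x, vnorm (pd e2 (recov α σ a A3 d w (h n) (ε n)) x) ^ p = 0 := fun n x => by
    rw [pd_e2_recov α σ a A3 d hw.contDiff, vnorm_zero, Real.zero_rpow hp.ne']
  simp only [e2_zero, add_zero, pd_e1_recov α hσ a A3 d hw.contDiff _ (hε _), one_smul]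
  have hmeas : ∀ n, Measurable fun x => ∑ i, qd f1 w (blow (α i) (jumpSign σ i) (ε n) (h n) x) +
      offset m σ • a := fun n => by
    have := measurable_pd (hcd n) e1
    simpa only [pd_e1_recov α hσ a A3 d hw.contDiff _ (hε _), one_smul] using this
  refine tendsto_setLIntegral_zero (isOpen_Om hωo).measurableSet (volume_Om_lt_top hωb)
    (fun n => (measurable_vnorm_rpow ((hcd n).continuous.measurable.sub
      (hubarc.measurable.comp measurable_fst)) p).add
      (measurable_vnorm_rpow ((hmeas n).sub (measurable_laminateSign_smul m α σ a)) p))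
    ((2 * 1) ^ p + (2 * (m * M + ‖offset m σ • a‖ + ‖a‖)) ^ p) ?_
    (ae_notMem_interfaces α) ?_
  · filter_upwards [hr, hlim.eventually_lt_const one_pos] with n hn hn1 x hx
    refine add_le_add (vnorm_rpow_le hp.le ?_)
      (vnorm_rpow_le hp.le (norm_blow_sum_le hσ hM (hh n) (hε n) hn hx.2 _))
    rw [hubar]
    exact (norm_recov_sub_le hσ hN (hh n) (hε n) hn hx.2).trans hn1.le
  · intro x hx hxα
    have hu : Tendsto (fun n => recov α σ a A3 d w (h n) (ε n) x - ubar x.1) atTop (𝓝 0) := by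
      refine squeeze_zero_norm' ?_ hlim
      filter_upwards [hr] with n hn
      rw [hubar]
      exact norm_recov_sub_le hσ hN (hh n) (hε n) hn hx.2
    refine (tendsto_vnorm_rpow hp hu).congr' ?_
    filter_upwards [hr, eventually_far hε0 L hxα] with n hn hfar
    rw [sum_blow_far hα hσ hw.tail1 hw.pos (hh n) (hε n) hn hx.2 hfar, sub_self, vnorm_zero,
      Real.zero_rpow hp.ne', add_zero]

end

/-! ### Slices of a planar convex set -/

theorem slice_nonempty {ω : Set (ℝ × ℝ)} (hωc : Convex ℝ ω) (hωne : ω.Nonempty) {t : ℝ}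
    (h1 : sInf (Prod.fst '' ω) < t) (h2 : t < sSup (Prod.fst '' ω)) :
    {s : ℝ | (t, s) ∈ ω}.Nonempty := by
  have hne : (Prod.fst '' ω).Nonempty := hωne.image _
  obtain ⟨x, hx, hxt⟩ := exists_lt_of_csInf_lt hne h1
  obtain ⟨y, hy, hty⟩ := exists_lt_of_lt_csSup hne h2
  have hc : Convex ℝ (Prod.fst '' ω) := hωc.linear_image (LinearMap.fst ℝ ℝ ℝ)
  obtain ⟨⟨t', s⟩, hs, rfl⟩ := hc.ordConnected.out hx hy ⟨hxt.le, hty.le⟩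
  exact ⟨s, hs⟩

theorem slice_isOpen {ω : Set (ℝ × ℝ)} (hωo : IsOpen ω) (t : ℝ) : IsOpen {s : ℝ | (t, s) ∈ ω} :=
  hωo.preimage (by fun_prop)

theorem slice_volume_lt_top {ω : Set (ℝ × ℝ)} (hωb : Bornology.IsBounded ω) (t : ℝ) :
    volume {s : ℝ | (t, s) ∈ ω} < ⊤ := by
  refine Bornology.IsBounded.measure_lt_top ((hωb.image_snd).subset ?_)
  exact fun s hs => ⟨(t, s), hs, rfl⟩

/-- Almost every point of a line meeting an open convex set is either in it or outside its
closure. -/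
theorem ae_mem_or_notMem_closure {ω : Set (ℝ × ℝ)} (hωo : IsOpen ω) (hωc : Convex ℝ ω) {t : ℝ}
    (hne : {s : ℝ | (t, s) ∈ ω}.Nonempty) :
    ∀ᵐ s : ℝ, (t, s) ∈ ω ∨ (t, s) ∉ closure ω := by
  set J := {s : ℝ | (t, s) ∈ ω}
  have hseg : ∀ u s : ℝ, ∀ r ∈ openSegment ℝ u s, (t, r) ∈ openSegment ℝ (t, u) (t, s) := by
    rintro u s r ⟨b, c, hb, hc, hbc, rfl⟩
    refine ⟨b, c, hb, hc, hbc, ?_⟩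
    ext
    · simp [← add_mul, hbc]
    · simp
  have hJc : Convex ℝ J := by
    refine convex_iff_openSegment_subset.2 fun u hu s hs r hr => ?_
    exact hωc.openSegment_subset hu hs (hseg u s r hr)
  have h0 : ∀ᵐ s : ℝ, s ∉ frontier J := by
    rw [ae_iff]
    simpa using hJc.addHaar_frontier volume
  obtain ⟨u, hu⟩ := hne
  filter_upwards [h0] with s hs
  by_cases hcl : (t, s) ∈ closure ω
  · left
    have hsJ : s ∈ closure J := by
      have hsub : openSegment ℝ u s ⊆ J := fun r hr => by
        have : (t, r) ∈ interior ω := hωc.openSegment_interior_closure_subset_interior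
          (by rwa [hωo.interior_eq]) hcl (hseg u s r hr)
        rwa [hωo.interior_eq] at this
      have := closure_mono hsub
      rw [closure_openSegment] at this
      exact this (right_mem_segment ℝ u s)
    by_contra hsω
    exact hs ⟨hsJ, fun h => hsω (interior_subset h : s ∈ J)⟩
  · exact Or.inr hcl

/-! ### Changes of variables -/

theorem lintegral_comp_affine {H : ℝ → ℝ≥0∞} (hH : Measurable H) (t : ℝ) {c : ℝ} (hc : c ≠ 0) :
    ∫⁻ x, H x = ENNReal.ofReal |c| * ∫⁻ z, H (t + c * z) := by
  have h1 : ∫⁻ x, H x = ∫⁻ x, H (t + x) := (lintegral_add_left_eq_self H t).symm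
  rw [h1]
  conv_lhs => rw [← Real.smul_map_volume_mul_left hc]
  rw [lintegral_smul_measure, lintegral_map (by fun_prop) (by fun_prop), smul_eq_mul]

theorem lintegral_prod_comp_affine {E : Type*} [MeasureSpace E] [SFinite (volume : Measure E)]
    {G : ℝ × E → ℝ≥0∞} (hG : Measurable G) (t : ℝ) {c : ℝ} (hc : c ≠ 0) :
    ∫⁻ x, G x = ENNReal.ofReal |c| * ∫⁻ z : ℝ × E, G (t + c * z.1, z.2) := by
  rw [Measure.volume_eq_prod, lintegral_prod _ hG.aemeasurable,
    lintegral_prod _ (by fun_prop), lintegral_comp_affine hG.lintegral_prod_right' t hc]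

/-! ### The energy of a single interface -/

theorem lintegral_blow {ω : Set (ℝ × ℝ)} (hωo : IsOpen ω) {g : Pt2 → ℝ} (hg : Continuous g)
    (α : ℝ) {s : ℝ} (hs : s = 1 ∨ s = -1) (h : ℝ) {ε : ℝ} (hε : 0 < ε) :
    ∫⁻ x in Om ω, ENNReal.ofReal (ε⁻¹ * g (blow α s ε h x)) =
      ∫⁻ z : Pt, (Om ω).indicator (fun _ => ENNReal.ofReal (g (z.1, s * (h / ε) * z.2.2)))
        (α + s * ε * z.1, z.2) := by
  have hS := (isOpen_Om hωo).measurableSet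
  have hgb : Measurable fun x => g (blow α s ε h x) :=
    (hg.comp (contDiff_blow α s ε h).continuous).measurable
  have hs0 : s * s = 1 := by rcases hs with rfl | rfl <;> norm_num
  have hsε : s * ε ≠ 0 := by rcases hs with rfl | rfl <;> simp [hε.ne']
  have habs : |s * ε| = ε := by rcases hs with rfl | rfl <;> simp [abs_of_pos hε]
  rw [← lintegral_indicator hS, lintegral_prod_comp_affine
    ((hgb.const_mul ε⁻¹).ennreal_ofReal.indicator hS) α hsε, habs,
    ← lintegral_const_mul]
  · refine lintegral_congr fun z => ?_
    by_cases hz : (α + s * ε * z.1, z.2) ∈ Om ω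
    · rw [indicator_of_mem hz, indicator_of_mem hz, ← ENNReal.ofReal_mul hε.le]
      have : blow α s ε h (α + s * ε * z.1, z.2) = (z.1, s * (h / ε) * z.2.2) := by
        unfold blow
        ext
        · simp only [add_sub_cancel_left]
          field_simp
          linear_combination z.1 * hs0
        · simp only []; ring
      rw [this, ← mul_assoc, mul_inv_cancel₀ hε.ne', one_mul]
    · rw [indicator_of_notMem hz, indicator_of_notMem hz, mul_zero]
  · exact ((hgb.const_mul ε⁻¹).ennreal_ofReal.indicator hS).comp (by fun_prop)

theorem lintegral_limit_profile {ω : Set (ℝ × ℝ)} (hωo : IsOpen ω) {W : M33 → ℝ} {w : Pt2 → V3}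
    (hg : Continuous (dens W w)) (α : ℝ) {s : ℝ} (hs : s = 1 ∨ s = -1) {γ : ℝ} (hγ : 0 < γ) :
    ∫⁻ z : Pt, (Om ω).indicator (fun _ => ENNReal.ofReal (dens W w (z.1, s * γ * z.2.2)))
        (α, z.2) = energy W γ w * volume {t : ℝ | (α, t) ∈ ω} := by
  have hgm := hg.measurable
  set J := {t : ℝ | (α, t) ∈ ω} with hJ
  have hJm : MeasurableSet J := (slice_isOpen hωo α).measurableSet
  set S := Ioo (-(γ / 2)) (γ / 2)
  set K : ℝ → ℝ → ℝ≥0∞ := fun z1 => S.indicator fun t => ENNReal.ofReal (dens W w (z1, t)) with hK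
  have hKm : ∀ z1, Measurable (K z1) := fun z1 =>
    (hgm.comp (by fun_prop)).ennreal_ofReal.indicator measurableSet_Ioo
  have hsγ : s * γ ≠ 0 := by rcases hs with rfl | rfl <;> simp [hγ.ne']
  have habs : |s * γ| = γ := by rcases hs with rfl | rfl <;> simp [abs_of_pos hγ]
  have hmemII : ∀ t : ℝ, s * γ * t ∈ S ↔ t ∈ II := by
    intro t
    unfold II
    simp only [S, mem_Ioo]
    have h1 : γ * (1 / 2) = γ / 2 := by ring
    rcases hs with rfl | rfl
    · constructor
      · rintro ⟨h, h'⟩; constructor <;> nlinarith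
      · rintro ⟨h, h'⟩; constructor <;> nlinarith
    · constructor
      · rintro ⟨h, h'⟩; constructor <;> nlinarith
      · rintro ⟨h, h'⟩; constructor <;> nlinarith
  have hint : ∀ z : Pt, (Om ω).indicator
      (fun _ => ENNReal.ofReal (dens W w (z.1, s * γ * z.2.2))) (α, z.2) =
      J.indicator 1 z.2.1 * K z.1 (s * γ * z.2.2) := by
    intro z
    by_cases h1 : z.2.1 ∈ J
    · rw [indicator_of_mem h1, Pi.one_apply, one_mul]
      by_cases h2 : z.2.2 ∈ II
      · rw [indicator_of_mem (show (α, z.2) ∈ Om ω from ⟨h1, h2⟩)]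
        simp only [hK]
        rw [indicator_of_mem ((hmemII _).2 h2)]
      · rw [indicator_of_notMem fun h : (α, z.2) ∈ Om ω => h2 h.2]
        simp only [hK]
        rw [indicator_of_notMem fun h => h2 ((hmemII _).1 h)]
    · rw [indicator_of_notMem h1, zero_mul,
        indicator_of_notMem fun h : (α, z.2) ∈ Om ω => h1 h.1]
  have hKu : Measurable fun y : Pt2 => K y.1 y.2 :=
    (hgm.ennreal_ofReal).indicator (measurableSet_Ioo.preimage measurable_snd)
  have hinner : ∀ z1, ∫⁻ z : ℝ × ℝ, J.indicator 1 z.1 * K z1 (s * γ * z.2) =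
      volume J * (ENNReal.ofReal γ⁻¹ * ∫⁻ t, K z1 t) := by
    intro z1
    rw [Measure.volume_eq_prod, lintegral_prod_mul (f := J.indicator 1)
      (g := fun t => K z1 (s * γ * t)) (measurable_one.indicator hJm).aemeasurable
      ((hKm z1).comp (by fun_prop)).aemeasurable, lintegral_indicator_one hJm]
    congr 1
    have := lintegral_comp_affine (hKm z1) 0 hsγ
    simp only [zero_add, habs] at this
    rw [this, ← mul_assoc, ← ENNReal.ofReal_mul (by positivity), inv_mul_cancel₀ hγ.ne',
      ENNReal.ofReal_one, one_mul]
  simp only [hint]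
  rw [Measure.volume_eq_prod, lintegral_prod _ ?_]
  · simp only [hinner]
    rw [lintegral_const_mul _ (hKu.lintegral_prod_right'.const_mul _),
      lintegral_const_mul _ hKu.lintegral_prod_right', mul_comm]
    congr 1
    unfold energy
    rw [← lintegral_indicator (MeasurableSet.univ.prod measurableSet_Ioo), Measure.volume_eq_prod,
      lintegral_prod _ (hgm.ennreal_ofReal.indicator
        (MeasurableSet.univ.prod measurableSet_Ioo)).aemeasurable]
    congr 2
    funext x
    congr 1
    funext y
    by_cases hy : y ∈ S
    · simp only [hK]
      rw [indicator_of_mem hy, indicator_of_mem (show (x, y) ∈ univ ×ˢ S from ⟨mem_univ _, hy⟩)]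
    · simp only [hK]
      rw [indicator_of_notMem hy, indicator_of_notMem fun h : (x, y) ∈ univ ×ˢ S => hy h.2]
  · exact (((measurable_one.indicator hJm).comp (by fun_prop)).mul
      (hKu.comp (by fun_prop : Measurable fun z : Pt => (z.1, s * γ * z.2.2)))).aemeasurable

theorem tendsto_single_interface {ω : Set (ℝ × ℝ)} (hωo : IsOpen ω) (hωc : Convex ℝ ω)
    (hωb : Bornology.IsBounded ω) (hωne : ω.Nonempty) {W : M33 → ℝ} (hWc : Continuous W)
    {a A3 : V3} (hp : W ![a, 0, A3] = 0) (hm : W ![-a, 0, -A3] = 0) {α : ℝ}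
    (hα1 : sInf (Prod.fst '' ω) < α) (hα2 : α < sSup (Prod.fst '' ω)) {s : ℝ}
    (hs : s = 1 ∨ s = -1) {w : Pt2 → V3} {L Γ γ : ℝ} (hw : IsProfile a A3 L Γ w) (hγ : 0 < γ)
    (hΓ : γ < Γ) {h ε : ℕ → ℝ} (hh : ∀ n, 0 < h n) (hε : ∀ n, 0 < ε n)
    (hε0 : Tendsto ε atTop (𝓝 0)) (hratio : Tendsto (fun n => h n / ε n) atTop (𝓝 γ)) :
    Tendsto (fun n => ∫⁻ x in Om ω, ENNReal.ofReal
      ((ε n)⁻¹ * dens W w (blow α s (ε n) (h n) x))) atTop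
      (𝓝 (energy W γ w * volume {t : ℝ | (α, t) ∈ ω})) := by
  have hg := continuous_dens hWc hw.contDiff
  have hgm := hg.measurable
  have hS := (isOpen_Om hωo).measurableSet
  simp only [fun n => lintegral_blow hωo hg α hs (h n) (hε n)]
  rw [← lintegral_limit_profile hωo hg α hs hγ]
  obtain ⟨R, hR⟩ := isBounded_iff_forall_norm_le.1 hωb
  obtain ⟨M, -, hM⟩ := exists_bound_core hg L (Γ / 2)
  set B : Set Pt := Icc (-L) L ×ˢ (Icc (-R) R ×ˢ Icc (-1) 1)
  have hB : MeasurableSet B := measurableSet_Icc.prod (measurableSet_Icc.prod measurableSet_Icc)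
  have hBfin : volume B < ⊤ :=
    (isCompact_Icc.prod (isCompact_Icc.prod isCompact_Icc)).measure_lt_top
  refine tendsto_lintegral_filter_of_dominated_convergence
    (B.indicator fun _ => ENNReal.ofReal M) ?_ ?_ ?_ ?_
  · refine Eventually.of_forall fun n => ?_
    have h1 : MeasurableSet ((fun z : Pt => (α + s * ε n * z.1, z.2)) ⁻¹' Om ω) :=
      hS.preimage (by fun_prop)
    exact ((hgm.comp (by fun_prop : Measurable fun z : Pt =>
      (z.1, s * (h n / ε n) * z.2.2))).ennreal_ofReal).indicator h1
  · filter_upwards [hratio.eventually_lt_const hΓ] with n hn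
    refine Eventually.of_forall fun z => ?_
    by_cases hz : (α + s * ε n * z.1, z.2) ∈ Om ω
    · have hz3 : |z.2.2| < 1 / 2 := abs_lt.2 ⟨by simpa using hz.2.1, hz.2.2⟩
      have hstrip : |s * (h n / ε n) * z.2.2| < Γ / 2 := by
        have h0 : 0 < h n / ε n := div_pos (hh n) (hε n)
        have : |s * (h n / ε n) * z.2.2| = h n / ε n * |z.2.2| := by
          rw [abs_mul, abs_mul, abs_of_pos h0]
          rcases hs with rfl | rfl <;> simp
        rw [this]
        nlinarith [abs_nonneg z.2.2]
      rw [indicator_of_mem hz]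
      by_cases hL : |z.1| ≤ L
      · have hzB : z ∈ B := by
          refine ⟨abs_le.1 hL, abs_le.1 ?_, abs_le.1 (by linarith)⟩
          exact (le_max_right _ _).trans (hR _ hz.1)
        rw [indicator_of_mem hzB]
        exact ENNReal.ofReal_le_ofReal ((Real.le_norm_self _).trans (hM _ hL hstrip.le))
      · rw [hw.dens_eq_zero hp hm hstrip (not_le.1 hL), ENNReal.ofReal_zero]
        exact zero_le
    · rw [indicator_of_notMem hz]
      exact zero_le
  · rw [lintegral_indicator_const hB]
    exact (ENNReal.mul_lt_top ENNReal.ofReal_lt_top hBfin).ne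
  · have hae : ∀ᵐ z : Pt, (α, z.2.1) ∈ ω ∨ (α, z.2.1) ∉ closure ω :=
      (Measure.quasiMeasurePreserving_fst.comp Measure.quasiMeasurePreserving_snd).ae
        (ae_mem_or_notMem_closure hωo hωc (slice_nonempty hωc hωne hα1 hα2))
    filter_upwards [hae] with z hz
    have hlim : Tendsto (fun n => (α + s * ε n * z.1, z.2.1)) atTop (𝓝 (α, z.2.1)) := by
      refine Tendsto.prodMk_nhds ?_ tendsto_const_nhds
      simpa using (((hε0.const_mul s).mul_const z.1).const_add α)
    by_cases hz3 : z.2.2 ∈ II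
    · rcases hz with hz | hz
      · rw [indicator_of_mem (show (α, z.2) ∈ Om ω from ⟨hz, hz3⟩)]
        have hgl : Tendsto (fun n => ENNReal.ofReal (dens W w (z.1, s * (h n / ε n) * z.2.2)))
            atTop (𝓝 (ENNReal.ofReal (dens W w (z.1, s * γ * z.2.2)))) :=
          ((ENNReal.continuous_ofReal.comp hg).tendsto _).comp
            (tendsto_const_nhds.prodMk_nhds ((hratio.const_mul s).mul_const z.2.2))
        refine hgl.congr' ?_
        filter_upwards [hlim.eventually (hωo.mem_nhds hz)] with n hn
        rw [indicator_of_mem (show (α + s * ε n * z.1, z.2) ∈ Om ω from ⟨hn, hz3⟩)]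
      · rw [indicator_of_notMem fun h : (α, z.2) ∈ Om ω => hz (subset_closure h.1)]
        refine tendsto_const_nhds.congr' ?_
        filter_upwards [hlim.eventually (isClosed_closure.isOpen_compl.mem_nhds hz)] with n hn
        rw [indicator_of_notMem fun h : (α + s * ε n * z.1, z.2) ∈ Om ω =>
          hn (subset_closure h.1)]
    · rw [indicator_of_notMem fun h : (α, z.2) ∈ Om ω => hz3 h.2]
      refine tendsto_const_nhds.congr fun n => ?_
      rw [indicator_of_notMem fun h : (α + s * ε n * z.1, z.2) ∈ Om ω => hz3 h.2]

theorem tendsto_F_recov {ω : Set (ℝ × ℝ)} (hωo : IsOpen ω) (hωc : Convex ℝ ω)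
    (hωb : Bornology.IsBounded ω) (hωne : ω.Nonempty) {W : M33 → ℝ} (hWc : Continuous W)
    (hW : ∀ ξ, 0 ≤ W ξ) {a A3 : V3} (hp : W ![a, 0, A3] = 0) (hm : W ![-a, 0, -A3] = 0) {m : ℕ}
    {α : Fin m → ℝ} (hα : StrictMono α)
    (hαin : ∀ i, sInf (Prod.fst '' ω) < α i ∧ α i < sSup (Prod.fst '' ω)) {σ : ℝ}
    (hσ : σ = 1 ∨ σ = -1) {w : Pt2 → V3} {L Γ γ : ℝ} (hw : IsProfile a A3 L Γ w) (d : V3)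
    (hγ : 0 < γ) (hΓ : γ < Γ) {h ε : ℕ → ℝ} (hh : ∀ n, 0 < h n) (hε : ∀ n, 0 < ε n)
    (hε0 : Tendsto ε atTop (𝓝 0)) (hratio : Tendsto (fun n => h n / ε n) atTop (𝓝 γ)) :
    Tendsto (fun n => F W (h n) (ε n) (recov α σ a A3 d w (h n) (ε n)) (Om ω)) atTop
      (𝓝 (energy W γ w * ∑ i, volume {t : ℝ | (α i, t) ∈ ω})) := by
  rw [Finset.mul_sum]
  refine (tendsto_finsetSum Finset.univ fun i _ => tendsto_single_interface hωo hωc hωb hωne hWc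
    hp hm (hαin i).1 (hαin i).2 (jumpSign_eq hσ i) hw hγ hΓ hh hε hε0 hratio).congr' ?_
  filter_upwards [hratio.eventually_lt_const hΓ, eventually_separated hα hε0 L] with n hn hsep
  rw [← lintegral_finsetSum]
  · refine setLIntegral_congr_fun (isOpen_Om hωo).measurableSet fun x hx => ?_
    rw [density_recov hp hm hα hσ hw d (hh n) (hε n) hn hx.2 hsep, ENNReal.ofReal_sum_of_nonneg]
    exact fun i _ => mul_nonneg (inv_nonneg.2 (hε n).le) (dens_nonneg hW w _)
  · exact fun i _ => ((((continuous_dens hWc hw.contDiff).comp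
      (contDiff_blow _ _ _ _).continuous).measurable).const_mul _).ennreal_ofReal

/-- Theorem 4.9, recovery sequences in the critical regime,
laminate case A' ≠ B'. -/
theorem statement11 (p : ℝ) (hp : 2 ≤ p) (A B : M33) (W : M33 → ℝ) (a : V3) (ha : a ≠ 0)
    (hWc : Continuous W) (h1 : H1 W A B) (h2 : H2 W p) (h3 : H3 W A B p) (h4 : H4 W)
    (hwells : Wells A B a) (γ : ℝ) (hγ : 0 < γ)
    (ω : Set (ℝ × ℝ)) (hωo : IsOpen ω) (hωc : Convex ℝ ω)
    (hωb : Bornology.IsBounded ω) (hωne : ω.Nonempty)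
    (m : ℕ) (hm : 0 < m) (α : Fin m → ℝ) (hαmono : StrictMono α)
    (hαin : ∀ i, sInf (Prod.fst '' ω) < α i ∧ α i < sSup (Prod.fst '' ω))
    (σ : ℝ) (hσ : σ = 1 ∨ σ = -1)
    (ubar : ℝ → V3) (hubarc : Continuous ubar)
    (hubar : ∀ t, t ∉ Set.range α →
      HasDerivAt ubar ((σ * (-1 : ℝ) ^ (cnt m α t)) • a) t)
    (h ε : ℕ → ℝ) (hh : ∀ n, 0 < h n) (hε : ∀ n, 0 < ε n)
    (hh0 : Tendsto h atTop (nhds 0)) (hε0 : Tendsto ε atTop (nhds 0))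
    (hratio : Tendsto (fun n => h n / ε n) atTop (nhds γ)) :
    ∃ un : ℕ → Pt → V3, (∀ n, ContDiff ℝ 2 (un n)) ∧
      Tendsto (fun n => ∫⁻ x in Om ω, ENNReal.ofReal
          ((vnorm (un n x - ubar x.1)) ^ p
            + (vnorm (pd e1 (un n) x - (σ * (-1 : ℝ) ^ (cnt m α x.1)) • a)) ^ p
            + (vnorm (pd e2 (un n) x)) ^ p)) atTop (nhds 0) ∧
      TendsLp (Om ω) p (fun n x => (h n)⁻¹ • pd e3 (un n) x)
        (fun x => (σ * (-1 : ℝ) ^ (cnt m α x.1)) • A 2) ∧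
      Tendsto (fun n => F W (h n) (ε n) (un n) (Om ω)) atTop
        (nhds (Kgam W a (A 2) γ * ∑ i : Fin m, volume {t : ℝ | (α i, t) ∈ ω})) := by
  have hp0 : 0 < p := by linarith
  obtain ⟨hAB, hA0, hA1⟩ := hwells
  have hA : W ![a, 0, A 2] = 0 := by
    refine (h1.2.1 _).2 (Or.inl ?_)
    ext i : 1
    fin_cases i
    · exact hA0.symm
    · exact hA1.symm
    · rfl
  have hB : W ![-a, 0, -A 2] = 0 := by
    refine (h1.2.1 _).2 (Or.inr ?_)
    have hB' : B = -A := by rw [hAB, neg_neg]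
    rw [hB']
    ext i : 1
    fin_cases i
    · exact congrArg Neg.neg hA0.symm
    · exact (by rw [hA1, neg_zero] : -A 1 = 0).symm
    · rfl
  obtain ⟨d, hd⟩ := laminate_eq hαmono σ hubarc hubar
  obtain ⟨w, L, Γ, hw, hlim⟩ := exists_profile_seq hWc hA hB hγ
  have hvol : ∑ i, volume {t : ℝ | (α i, t) ∈ ω} ≠ ⊤ :=
    (ENNReal.sum_lt_top.2 fun i _ => slice_volume_lt_top hωb (α i)).ne
  obtain ⟨φ, hφ⟩ := exists_diagonal_tendsto _ _ _
    (fun k => ((tendsto_recov_pd_e1 (p := p) hωo hωb hp0 hαmono hσ (hw k).2 (hw k).1 hubarc hd hh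
      hε hh0 hε0 hratio).prodMk_nhds (tendsto_recov_pd_e3 (p := p) (d := d) hωo hωb hp0 hαmono hσ
      (hw k).2 (hw k).1 hh hε hε0 hratio)).prodMk_nhds (tendsto_F_recov hωo hωc hωb hωne hWc h1.1
      hA hB hαmono hαin hσ (hw k).2 d hγ (hw k).1 hh hε hε0 hratio))
    ((tendsto_const_nhds (x := ((0 : ℝ≥0∞), (0 : ℝ≥0∞)))).prodMk_nhds
      (ENNReal.Tendsto.mul_const hlim (Or.inr hvol)))
  refine ⟨fun n => recov α σ a (A 2) d (w (φ n)) (h n) (ε n),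
    fun n => contDiff_recov α σ a (A 2) d (hw (φ n)).2.contDiff _ _, ?_, ?_, ?_⟩
  · exact hφ.fst_nhds.fst_nhds
  · exact hφ.fst_nhds.snd_nhds
  · exact hφ.snd_nhds
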